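/- arXiv:1410.4929 — 11 statements merged into one kernel-verified Lean document; each statement's English description precedes it below -/
import Mathlib

section
/- Let X and Y be complex Banach spaces, let A0 : X → Y be a boundedly invertible bounded linear operator with ‖A0⁻¹‖ ≤ 1/μ0 for some μ0 > 0, let (Aj)_{j≥1} be bounded linear operators from X to Y, and set β_{0,j} = ‖A0⁻¹ ∘ Aj‖. Let δ ∈ (0,1) and let ρ = (ρ_j)_{j≥1} be a sequence of nonnegative reals with ∑_{j≥1} ρ_j β_{0,j} ≤ 1 - δ. Then for every complex sequence z = (z_j)_{j≥1} with |z_j| ≤ ρ_j for all j, the series A(z) = A0 + ∑_{j≥1} z_j Aj converges in operator norm, A(z) is boundedly invertible, and for every f ∈ Y the unique solution u(z) ∈ X of A(z) u(z) = f satisfies ‖u(z)‖_X ≤ ‖f‖_Y / (δ μ0). -/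
/-- Complex version on a polydisc. If `ρ = (ρⱼ)` is δ-admissible, i.e.
`∑ⱼ ρⱼ β_{0,j} ≤ 1 - δ` with `β_{0,j} = ‖A0⁻¹ ∘ Aⱼ‖`, then for every complex sequence `z`
with `|zⱼ| ≤ ρⱼ` the series `A(z) = A0 + ∑ⱼ zⱼ Aⱼ` converges in operator norm, `A(z)` is
boundedly invertible and the unique solution of `A(z) u = f` satisfies `‖u‖ ≤ ‖f‖/(δ μ0)`. -/
theorem stmt1
    {X Y : Type*} [NormedAddCommGroup X] [NormedSpace ℂ X] [CompleteSpace X]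
    [NormedAddCommGroup Y] [NormedSpace ℂ Y] [CompleteSpace Y]
    (A0 : X →L[ℂ] Y) (A0inv : Y →L[ℂ] X)
    (hleft : ∀ x, A0inv (A0 x) = x) (hright : ∀ w, A0 (A0inv w) = w)
    (μ0 : ℝ) (hμ0 : 0 < μ0) (hA0inv : ‖A0inv‖ ≤ 1 / μ0)
    (A : ℕ → X →L[ℂ] Y) (δ : ℝ) (hδ0 : 0 < δ) (hδ1 : δ < 1)
    (ρ : ℕ → ℝ) (hρ : ∀ j, 0 ≤ ρ j)
    (hsum : Summable fun j => ρ j * ‖A0inv.comp (A j)‖)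
    (hadm : (∑' j, ρ j * ‖A0inv.comp (A j)‖) ≤ 1 - δ)
    (z : ℕ → ℂ) (hz : ∀ j, ‖z j‖ ≤ ρ j) :
    ∃ S : X →L[ℂ] Y, HasSum (fun j => z j • A j) S ∧
      (∃ Binv : Y →L[ℂ] X,
        (∀ x, Binv ((A0 + S) x) = x) ∧ (∀ w, (A0 + S) (Binv w) = w)) ∧
      ∀ f : Y, (∃! u : X, (A0 + S) u = f) ∧
        ∀ u : X, (A0 + S) u = f → ‖u‖ ≤ ‖f‖ / (δ * μ0) := by
  have hbound (j : ℕ) : ‖z j • A0inv.comp (A j)‖ ≤ ρ j * ‖A0inv.comp (A j)‖ := by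
    rw [norm_smul]
    exact mul_le_mul_of_nonneg_right (hz j) (norm_nonneg _)
  have hsummable : Summable fun j => z j • A0inv.comp (A j) :=
    Summable.of_norm_bounded hsum hbound
  obtain ⟨T, hT⟩ := hsummable
  have hTnorm : ‖T‖ ≤ 1 - δ := by
    rw [← hT.tsum_eq]
    exact (tsum_of_norm_bounded hsum.hasSum hbound).trans hadm
  have hS : HasSum (fun j => z j • A j) (A0.comp T) := by
    have h := hT.mapL (ContinuousLinearMap.compL ℂ X X Y A0)
    convert h using 1
    · ext j x
      simp [hright]
    · rfl
  have hunit : IsUnit (1 + T) := by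
    have h : ‖-T‖ < 1 := by
      rw [norm_neg]
      linarith
    simpa using isUnit_one_sub_of_norm_lt_one h
  obtain ⟨R, hR₁, hR₂⟩ := isUnit_iff_exists.mp hunit
  have hfactor (x : X) : (A0 + A0.comp T) x = A0 ((1 + T) x) := by simp
  have hinv_left (x : X) : (R.comp A0inv) ((A0 + A0.comp T) x) = x := by
    rw [hfactor, ContinuousLinearMap.comp_apply, hleft]
    exact DFunLike.congr_fun hR₂ x
  have hinv_right (w : Y) : (A0 + A0.comp T) ((R.comp A0inv) w) = w := by
    rw [hfactor, ContinuousLinearMap.comp_apply]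
    have h : (1 + T) (R (A0inv w)) = A0inv w := DFunLike.congr_fun hR₁ (A0inv w)
    rw [h, hright]
  refine ⟨A0.comp T, hS, ⟨R.comp A0inv, hinv_left, hinv_right⟩, fun f => ⟨?_, ?_⟩⟩
  · refine ⟨(R.comp A0inv) f, hinv_right f, fun u hu => ?_⟩
    rw [← hu, hinv_left]
  · intro u hu
    have hfix : u = A0inv f - T u := by
      rw [← hu, hfactor, hleft]
      simp
    have hu_le : ‖u‖ ≤ 1 / μ0 * ‖f‖ + (1 - δ) * ‖u‖ :=
      calc ‖u‖ = ‖A0inv f - T u‖ := congrArg norm hfix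
        _ ≤ ‖A0inv f‖ + ‖T u‖ := norm_sub_le _ _
        _ ≤ _ := add_le_add (A0inv.le_of_opNorm_le hA0inv f) (T.le_of_opNorm_le hTnorm u)
    have hmul : δ * ‖u‖ ≤ ‖f‖ / μ0 := by
      rw [one_div_mul_eq_div] at hu_le
      linarith
    rw [le_div_iff₀ (mul_pos hδ0 hμ0)]
    rw [le_div_iff₀ hμ0] at hmul
    linarith
end

section
/- Let 0 < p < 1 and let (β_j)_{j≥1} be a nonincreasing sequence of nonnegative real numbers with ∑_{j≥1} β_j^p < ∞. Then for every J ∈ ℕ with J ≥ 1: ∑_{j ≥ J+1} β_j ≤ min(1/(1/p - 1), 1) · (∑_{j≥1} β_j^p)^{1/p} · J^{-(1/p - 1)}. -/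
theorem Antitone.mul_rpow_le_tsum_rpow {p : ℝ} (hp : 0 ≤ p) {β : ℕ → ℝ} (hβ : Antitone β)
    (hnonneg : ∀ j, 0 ≤ β j) (hsum : Summable fun j => β j ^ p) (n : ℕ) :
    ((n : ℝ) + 1) * β n ^ p ≤ ∑' j, β j ^ p := by
  calc ((n : ℝ) + 1) * β n ^ p = ∑ _j ∈ Finset.range (n + 1), β n ^ p := by simp
    _ ≤ ∑ j ∈ Finset.range (n + 1), β j ^ p := by
      refine Finset.sum_le_sum fun j hj => Real.rpow_le_rpow (hnonneg n) (hβ ?_) hp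
      exact Nat.lt_succ_iff.mp (Finset.mem_range.mp hj)
    _ ≤ ∑' j, β j ^ p :=
      hsum.sum_le_tsum _ fun j _ => Real.rpow_nonneg (hnonneg j) p

theorem Antitone.le_tsum_rpow_mul_rpow {p : ℝ} (hp : 0 < p) {β : ℕ → ℝ} (hβ : Antitone β)
    (hnonneg : ∀ j, 0 ≤ β j) (hsum : Summable fun j => β j ^ p) (n : ℕ) :
    β n ≤ (∑' j, β j ^ p) ^ (1 / p) * ((n : ℝ) + 1) ^ (-(1 / p)) := by
  have hn : (0 : ℝ) < n + 1 := by positivity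
  have hS : 0 ≤ ∑' j, β j ^ p := tsum_nonneg fun j => Real.rpow_nonneg (hnonneg j) p
  have h : β n ^ p ≤ (∑' j, β j ^ p) / (n + 1) := by
    rw [le_div_iff₀ hn, mul_comm]
    exact hβ.mul_rpow_le_tsum_rpow hp.le hnonneg hsum n
  calc β n = (β n ^ p) ^ (1 / p) := by
        rw [← Real.rpow_mul (hnonneg n), mul_one_div_cancel hp.ne', Real.rpow_one]
    _ ≤ ((∑' j, β j ^ p) / (n + 1)) ^ (1 / p) :=
        Real.rpow_le_rpow (Real.rpow_nonneg (hnonneg n) p) h (by positivity)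
    _ = _ := by rw [Real.div_rpow hS hn.le, Real.rpow_neg hn.le, div_eq_mul_inv]

/-- The integral-test increment bound `s (x + 1)^{-(s+1)} ≤ x^{-s} - (x + 1)^{-s}`. -/
theorem Real.mul_rpow_neg_succ_le_sub {s x : ℝ} (hs : 0 ≤ s) (hx : 0 < x) :
    s * (x + 1) ^ (-(s + 1)) ≤ x ^ (-s) - (x + 1) ^ (-s) := by
  have hx1 : 0 < x + 1 := by positivity
  have hlog : 1 / (x + 1) ≤ Real.log (x + 1) - Real.log x := by
    have h := Real.log_le_sub_one_of_pos (div_pos hx hx1)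
    rw [Real.log_div hx.ne' hx1.ne'] at h
    have h' : x / (x + 1) = 1 - 1 / (x + 1) := by field_simp; ring
    linarith
  have hmul : x ^ (-s) = (x + 1) ^ (-s) * Real.exp (s * (Real.log (x + 1) - Real.log x)) := by
    rw [Real.rpow_def_of_pos hx, Real.rpow_def_of_pos hx1, ← Real.exp_add]
    ring_nf
  have hexp : 1 + s * (1 / (x + 1)) ≤ Real.exp (s * (Real.log (x + 1) - Real.log x)) := by
    have h := Real.add_one_le_exp (s * (Real.log (x + 1) - Real.log x))
    have h' := mul_le_mul_of_nonneg_left hlog hs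
    linarith
  have hpow : (x + 1) ^ (-(s + 1)) = (x + 1) ^ (-s) * (1 / (x + 1)) := by
    rw [neg_add, Real.rpow_add hx1, Real.rpow_neg_one, one_div]
  have h := mul_le_mul_of_nonneg_left hexp (Real.rpow_nonneg hx1.le (-s))
  rw [hmul, hpow]
  linarith

theorem Real.mul_sum_range_rpow_neg_le {s : ℝ} (hs : 0 ≤ s) {J : ℕ} (hJ : 1 ≤ J) (m : ℕ) :
    s * ∑ j ∈ Finset.range m, (((J + j : ℕ) : ℝ) + 1) ^ (-(s + 1)) ≤ (J : ℝ) ^ (-s) := by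
  have h : s * ∑ j ∈ Finset.range m, (((J + j : ℕ) : ℝ) + 1) ^ (-(s + 1)) ≤
      (J : ℝ) ^ (-s) - ((J + m : ℕ) : ℝ) ^ (-s) := by
    induction m with
    | zero => simp
    | succ m ih =>
      have hpos : (0 : ℝ) < ((J + m : ℕ) : ℝ) := by exact_mod_cast (by omega : 0 < J + m)
      have h := Real.mul_rpow_neg_succ_le_sub hs hpos
      rw [Finset.sum_range_succ, mul_add, ← add_assoc J m 1, Nat.cast_succ (J + m)]
      linarith
  have h' := Real.rpow_nonneg (Nat.cast_nonneg (α := ℝ) (J + m)) (-s)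
  linarith

/-- Stechkin-type tail bound. For a nonincreasing nonnegative sequence `β`
(0-indexed, `β 0` playing the role of `β_1`) with `∑ⱼ βⱼ^p < ∞`, `0 < p < 1`, and every
`J ≥ 1`: `∑_{j ≥ J+1} βⱼ ≤ min(1/(1/p - 1), 1) (∑ⱼ βⱼ^p)^{1/p} J^{-(1/p-1)}`, where the tail
`∑_{j ≥ J+1} βⱼ` in 1-based indexing is `∑' j, β (J + j)` in 0-based indexing. -/
theorem stmt3 (p : ℝ) (hp0 : 0 < p) (hp1 : p < 1) (β : ℕ → ℝ)
    (hnonneg : ∀ j, 0 ≤ β j) (hmono : ∀ j, β (j + 1) ≤ β j)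
    (hsum : Summable fun j => β j ^ p) :
    ∀ J : ℕ, 1 ≤ J →
      (∑' j, β (J + j)) ≤
        min (1 / (1 / p - 1)) 1 * (∑' j, β j ^ p) ^ (1 / p) * (J : ℝ) ^ (-(1 / p - 1)) := by
  intro J hJ
  have hβ : Antitone β := antitone_nat_of_succ_le hmono
  have hs : 0 < 1 / p - 1 := by
    have := (one_lt_div hp0).mpr hp1
    linarith
  have hJ0 : (0 : ℝ) < J := by exact_mod_cast hJ
  have hS : 0 ≤ ∑' j, β j ^ p := tsum_nonneg fun j => Real.rpow_nonneg (hnonneg j) p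
  refine Real.tsum_le_of_sum_range_le (fun j => hnonneg _) fun m => ?_
  rw [mul_assoc, min_mul_of_nonneg _ _ (by positivity), one_mul]
  refine le_min ?_ ?_
  · calc ∑ j ∈ Finset.range m, β (J + j)
        ≤ ∑ j ∈ Finset.range m,
          (∑' j, β j ^ p) ^ (1 / p) * (((J + j : ℕ) : ℝ) + 1) ^ (-(1 / p)) :=
        Finset.sum_le_sum fun j _ => hβ.le_tsum_rpow_mul_rpow hp0 hnonneg hsum (J + j)
      _ = (∑' j, β j ^ p) ^ (1 / p) *
          ∑ j ∈ Finset.range m, (((J + j : ℕ) : ℝ) + 1) ^ (-(1 / p - 1 + 1)) := by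
        rw [← Finset.mul_sum, sub_add_cancel]
      _ ≤ (∑' j, β j ^ p) ^ (1 / p) * (1 / (1 / p - 1) * (J : ℝ) ^ (-(1 / p - 1))) := by
        refine mul_le_mul_of_nonneg_left ?_ (Real.rpow_nonneg hS _)
        rw [one_div_mul_eq_div, le_div_iff₀ hs, mul_comm]
        exact Real.mul_sum_range_rpow_neg_le hs.le hJ m
      _ = _ := by ring
  · have hterm (j : ℕ) : β (J + j) ≤
        β (J + j) ^ p * ((∑' j, β j ^ p) ^ (1 / p - 1) * (J : ℝ) ^ (-(1 / p - 1))) := by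
      have hb := hnonneg (J + j)
      have hle : β (J + j) ^ p ≤ (∑' j, β j ^ p) / J := by
        rw [le_div_iff₀ hJ0, mul_comm]
        refine le_trans (mul_le_mul_of_nonneg_right ?_ (Real.rpow_nonneg hb p))
          (hβ.mul_rpow_le_tsum_rpow hp0.le hnonneg hsum (J + j))
        push_cast
        linarith [Nat.cast_nonneg (α := ℝ) j]
      calc β (J + j) = β (J + j) ^ p * (β (J + j) ^ p) ^ (1 / p - 1) := by
            rw [← Real.rpow_mul hb, ← Real.rpow_add_of_nonneg hb hp0.le (by positivity),
              show p + p * (1 / p - 1) = 1 by field_simp; ring, Real.rpow_one]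
        _ ≤ β (J + j) ^ p * ((∑' j, β j ^ p) / J) ^ (1 / p - 1) :=
            mul_le_mul_of_nonneg_left
              (Real.rpow_le_rpow (Real.rpow_nonneg hb p) hle hs.le) (Real.rpow_nonneg hb p)
        _ = _ := by rw [Real.div_rpow hS hJ0.le, Real.rpow_neg hJ0.le, div_eq_mul_inv]
    have htail : ∑ j ∈ Finset.range m, β (J + j) ^ p ≤ ∑' j, β j ^ p := by
      have h := hsum.sum_le_tsum ((Finset.range m).map (addLeftEmbedding J))
        fun j _ => Real.rpow_nonneg (hnonneg j) p
      simpa only [Finset.sum_map, addLeftEmbedding_apply] using h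
    calc ∑ j ∈ Finset.range m, β (J + j)
        ≤ ∑ j ∈ Finset.range m, β (J + j) ^ p *
          ((∑' j, β j ^ p) ^ (1 / p - 1) * (J : ℝ) ^ (-(1 / p - 1))) :=
        Finset.sum_le_sum fun j _ => hterm j
      _ ≤ (∑' j, β j ^ p) *
          ((∑' j, β j ^ p) ^ (1 / p - 1) * (J : ℝ) ^ (-(1 / p - 1))) := by
        rw [← Finset.sum_mul]
        exact mul_le_mul_of_nonneg_right htail (by positivity)
      _ = _ := by
        rw [← mul_assoc]
        congr 1
        nth_rewrite 1 [← Real.rpow_one (∑' j, β j ^ p)]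
        rw [← Real.rpow_add_of_nonneg hS zero_le_one hs.le, add_sub_cancel]
end

section
/- Let ω = (ω_j)_{j∈ℕ} be a bounded weight sequence with ω_j ≥ 1 for all j, let 0 < p < q ≤ 2, and let x = (x_j)_{j∈ℕ} be a real sequence with |||x|||_{ω,p} := (∑_j |x_j|^p ω_j^{2-p})^{1/p} < ∞. Then for every real s ≥ 2 sup_j ω_j there exists a sequence z that is weighted s-sparse, i.e. ∑_{j ∈ supp z} ω_j² ≤ s, such that |||x - z|||_{ω,q} ≤ 2^{1/p - 1/q} s^{1/q - 1/p} |||x|||_{ω,p}. -/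
/-- Markov's inequality for the weighted quasi-norm: where `|a| / w` exceeds `t`, the mass `w ^ 2`
is controlled by the summand of the quasi-norm. -/
theorem rpow_mul_sq_le_of_mul_lt {a w t p : ℝ} (hw : 0 < w) (ht : 0 ≤ t) (hp : 0 < p)
    (h : t * w < |a|) : t ^ p * w ^ 2 ≤ |a| ^ p * w ^ (2 - p) := by
  have hw2 : w ^ 2 = w ^ p * w ^ (2 - p) := by
    rw [← Real.rpow_add hw, add_sub_cancel, Real.rpow_two]
  rw [hw2, ← mul_assoc, ← Real.mul_rpow ht hw.le]
  gcongr

/-- Where `|a| / w` is at most `t`, the summand with exponent `q` is controlled by the summand with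
the smaller exponent `p`. -/
theorem rpow_mul_rpow_le_of_le_mul {a w t p q : ℝ} (hw : 0 < w) (ht : 0 ≤ t) (hp : 0 < p)
    (hpq : p < q) (h : |a| ≤ t * w) :
    |a| ^ q * w ^ (2 - q) ≤ t ^ (q - p) * (|a| ^ p * w ^ (2 - p)) := by
  have ha : |a| ^ q = |a| ^ p * |a| ^ (q - p) := by
    rw [← Real.rpow_add_of_nonneg (abs_nonneg a) hp.le (sub_pos.2 hpq).le, add_sub_cancel]
  have hw2 : w ^ (2 - p) = w ^ (q - p) * w ^ (2 - q) := by
    rw [← Real.rpow_add hw]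
    congr 1
    ring
  calc |a| ^ q * w ^ (2 - q) = |a| ^ p * |a| ^ (q - p) * w ^ (2 - q) := by rw [ha]
    _ ≤ |a| ^ p * (t * w) ^ (q - p) * w ^ (2 - q) := by
      have := Real.rpow_le_rpow (abs_nonneg a) h (sub_pos.2 hpq).le
      gcongr
    _ = t ^ (q - p) * (|a| ^ p * w ^ (2 - p)) := by
      rw [Real.mul_rpow ht hw.le, hw2]
      ring

/-- The bound on the error in terms of the threshold `(2 * N / s) ^ (1 / p)`. -/
theorem threshold_rpow_mul_rpow {N s p q : ℝ} (hN : 0 < N) (hs : 0 < s) (hp : 0 < p) (hq : 0 < q) :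
    (((2 * N / s) ^ (1 / p)) ^ (q - p) * N) ^ (1 / q) =
      2 ^ (1 / p - 1 / q) * s ^ (1 / q - 1 / p) * N ^ (1 / p) := by
  have he : 1 / p * ((q - p) * (1 / q)) = 1 / p - 1 / q := by
    field_simp
  have hs' : s ^ (1 / q - 1 / p) = (s ^ (1 / p - 1 / q))⁻¹ := by
    rw [← Real.rpow_neg hs.le, neg_sub]
  have hN' : N ^ (1 / p) = N ^ (1 / p - 1 / q) * N ^ (1 / q) := by
    rw [← Real.rpow_add hN, sub_add_cancel]
  rw [Real.mul_rpow (by positivity) hN.le, ← Real.rpow_mul (by positivity),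
    ← Real.rpow_mul (by positivity), he, Real.div_rpow (by positivity) hs.le,
    Real.mul_rpow zero_le_two hN.le, hs', hN']
  ring

/-- Weighted Stechkin estimate. For weights `ωⱼ ≥ 1` that are bounded,
`0 < p < q ≤ 2`, and a sequence `x` with finite weighted quasi-norm
`|||x|||_{ω,p} = (∑ⱼ |xⱼ|^p ωⱼ^{2-p})^{1/p}`, for every `s ≥ 2 supⱼ ωⱼ` there is a weighted
`s`-sparse sequence `z` (i.e. `∑_{j ∈ supp z} ωⱼ² ≤ s`) with
`|||x - z|||_{ω,q} ≤ 2^{1/p-1/q} s^{1/q-1/p} |||x|||_{ω,p}`. -/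
theorem stmt4 (ω : ℕ → ℝ) (hω : ∀ j, 1 ≤ ω j) (hbdd : BddAbove (Set.range ω))
    (p q : ℝ) (hp : 0 < p) (hpq : p < q) (hq : q ≤ 2)
    (x : ℕ → ℝ) (hx : Summable fun j => |x j| ^ p * ω j ^ (2 - p))
    (s : ℝ) (hs : 2 * (⨆ j, ω j) ≤ s) :
    ∃ (z : ℕ → ℝ) (hzfin : (Function.support z).Finite),
      (∑ j ∈ hzfin.toFinset, ω j ^ 2) ≤ s ∧
      Summable (fun j => |x j - z j| ^ q * ω j ^ (2 - q)) ∧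
      (∑' j, |x j - z j| ^ q * ω j ^ (2 - q)) ^ (1 / q) ≤
        2 ^ (1 / p - 1 / q) * s ^ (1 / q - 1 / p) *
          (∑' j, |x j| ^ p * ω j ^ (2 - p)) ^ (1 / p) := by
  have hω0 : ∀ j, 0 < ω j := fun j => one_pos.trans_le (hω j)
  have hs0 : 0 < s := by
    linarith [le_ciSup hbdd 0, hω 0]
  have hq0 : 0 < q := hp.trans hpq
  have hnonneg : ∀ j, 0 ≤ |x j| ^ p * ω j ^ (2 - p) := fun j =>
    mul_nonneg (Real.rpow_nonneg (abs_nonneg _) _) (Real.rpow_nonneg (hω0 j).le _)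
  set N := ∑' j, |x j| ^ p * ω j ^ (2 - p) with hN
  have hN_nonneg : 0 ≤ N := tsum_nonneg hnonneg
  rcases hN_nonneg.eq_or_lt with hN0 | hN0
  · have hx0 : ∀ j, x j = 0 := fun j => by
      have hj := (hx.hasSum_iff.2 hN0.symm |> (hasSum_zero_iff_of_nonneg hnonneg).1 |> congrFun) j
      rcases mul_eq_zero.1 hj with h | h
      · exact abs_eq_zero.1 ((Real.rpow_eq_zero (abs_nonneg _) hp.ne').1 h)
      · exact absurd h (Real.rpow_pos_of_pos (hω0 j) _).ne'
    refine ⟨0, by simp, by simpa using hs0.le, ?_, ?_⟩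
    · simp [hx0, Real.zero_rpow hq0.ne', summable_zero]
    · have hR : 0 ≤ 2 ^ (1 / p - 1 / q) * s ^ (1 / q - 1 / p) * N ^ (1 / p) := by positivity
      simpa [hx0, Real.zero_rpow hq0.ne', Real.zero_rpow (inv_pos.2 hq0).ne'] using hR
  set t := (2 * N / s) ^ (1 / p) with ht
  have ht0 : 0 < t := by positivity
  have htp : t ^ p = 2 * N / s := by
    rw [ht, ← Real.rpow_mul (by positivity), one_div_mul_cancel hp.ne', Real.rpow_one]
  set T : Set ℕ := {j | t * ω j < |x j|}
  have hmarkov : ∀ j ∈ T, t ^ p * ω j ^ 2 ≤ |x j| ^ p * ω j ^ (2 - p) := fun j hj =>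
    rpow_mul_sq_le_of_mul_lt (hω0 j) ht0.le hp hj
  have hTfin : T.Finite := by
    have hev := hx.tendsto_cofinite_zero.eventually (gt_mem_nhds (Real.rpow_pos_of_pos ht0 p))
    refine (Filter.eventually_cofinite.1 hev).subset fun j hj => not_lt.2 ?_
    exact (le_mul_of_one_le_right (by positivity) (one_le_pow₀ (hω j))).trans (hmarkov j hj)
  have hsupp : Function.support (T.indicator x) ⊆ T := Set.support_indicator_subset
  have hle : ∀ j, |x j - T.indicator x j| ^ q * ω j ^ (2 - q) ≤
      t ^ (q - p) * (|x j| ^ p * ω j ^ (2 - p)) := fun j => by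
    by_cases hj : j ∈ T
    · simpa [hj, Real.zero_rpow hq0.ne'] using
        mul_nonneg (Real.rpow_nonneg ht0.le (q - p)) (hnonneg j)
    · simpa [hj] using rpow_mul_rpow_le_of_le_mul (hω0 j) ht0.le hp hpq (not_lt.1 hj)
  have hnonneg' : ∀ j, 0 ≤ |x j - T.indicator x j| ^ q * ω j ^ (2 - q) := fun j =>
    mul_nonneg (Real.rpow_nonneg (abs_nonneg _) _) (Real.rpow_nonneg (hω0 j).le _)
  have hsum := Summable.of_nonneg_of_le hnonneg' hle (hx.mul_left _)
  refine ⟨T.indicator x, hTfin.subset hsupp, ?_, hsum, ?_⟩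
  · set F := (hTfin.subset hsupp).toFinset with hF
    have hmass : 2 * N / s * ∑ j ∈ F, ω j ^ 2 ≤ N := by
      rw [← htp, Finset.mul_sum]
      refine (Finset.sum_le_sum fun j hj => hmarkov j (hsupp ?_)).trans
        (hx.sum_le_tsum F fun j _ => hnonneg j)
      simpa only [hF, Set.Finite.mem_toFinset] using hj
    rw [div_mul_eq_mul_div, div_le_iff₀ hs0] at hmass
    have hmass' : 2 * ∑ j ∈ F, ω j ^ 2 ≤ s := by
      refine le_of_mul_le_mul_left ?_ hN0
      linarith
    linarith [Finset.sum_nonneg fun j (_ : j ∈ F) => sq_nonneg (ω j)]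
  · rw [← threshold_rpow_mul_rpow hN0 hs0 hp hq0]
    refine Real.rpow_le_rpow (tsum_nonneg hnonneg') ?_ (by positivity)
    rw [hN, ← tsum_mul_left]
    exact hsum.tsum_le_tsum hle (hx.mul_left _)
end

section
/- Let X and Y be complex Banach spaces, A0 : X → Y boundedly invertible with ‖A0⁻¹‖ ≤ 1/μ0 for some μ0 > 0, and (Aj)_{j≥1} bounded linear operators from X to Y with β_{0,j} = ‖A0⁻¹ ∘ Aj‖. Let δ ∈ (0,1) and let ρ = (ρ_j)_{j≥1} satisfy ρ_j ≥ 1 for all j and ∑_{j≥1} ρ_j β_{0,j} ≤ 1 - δ. For f ∈ Y and y ∈ U = [-1,1]^ℕ let u(y) = (A0 + ∑_{j≥1} y_j Aj)⁻¹ f ∈ X. Then for every finitely supported multi-index ν ∈ F the function y ↦ u(y) T_ν(y) is Bochner integrable with respect to the product Chebyshev measure η on U, and the Chebyshev coefficient d_ν = ∫_U u(y) T_ν(y) dη(y) ∈ X satisfies ‖d_ν‖_X ≤ (δ μ0)⁻¹ ‖f‖_Y · 2^{‖ν‖₀/2} · ∏_{j≥1} ρ_j^{-ν_j}, where ‖ν‖₀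 = #{ j : ν_j ≠ 0 }. -/
open MeasureTheory

/-- The L²-normalized Chebyshev polynomials: `T 0 = 1`, `T n t = √2 cos (n arccos t)`. -/
noncomputable def chebFun (n : ℕ) (t : ℝ) : ℝ :=
  if n = 0 then 1 else Real.sqrt 2 * Real.cos (n * Real.arccos t)

/-- The Chebyshev (arcsine) probability measure `dσ(t) = dt/(π √(1-t²))` on `(-1,1)`. -/
noncomputable def chebMeasure : Measure ℝ :=
  (volume.restrict (Set.Ioo (-1 : ℝ) 1)).withDensity
    (fun t => ENNReal.ofReal (1 / (Real.pi * Real.sqrt (1 - t ^ 2))))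

/-- `η` is the countable product of the Chebyshev measures: a probability measure on `ℝ^ℕ`
whose finite-dimensional cylinder marginals are products of `chebMeasure`. -/
def IsChebProductMeasure (η : Measure (ℕ → ℝ)) : Prop :=
  IsProbabilityMeasure η ∧
    ∀ (s : Finset ℕ) (B : ℕ → Set ℝ), (∀ i, MeasurableSet (B i)) →
      η {y | ∀ i ∈ s, y i ∈ B i} = ∏ i ∈ s, chebMeasure (B i)

/-- The tensorized Chebyshev polynomial `T_ν(y) = ∏_{j ∈ supp ν} T_{ν_j}(y_j)`. -/
noncomputable def chebProd (ν : ℕ →₀ ℕ) (y : ℕ → ℝ) : ℝ :=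
  ∏ j ∈ ν.support, chebFun (ν j) (y j)

open Filter

lemma continuous_chebFun (n : ℕ) : Continuous (chebFun n) := by
  unfold chebFun
  split_ifs
  · exact continuous_const
  · have := Real.continuous_arccos
    fun_prop

lemma abs_chebFun_le (n : ℕ) (t : ℝ) : |chebFun n t| ≤ if n = 0 then 1 else Real.sqrt 2 := by
  unfold chebFun
  split_ifs
  · simp
  · rw [abs_mul, abs_of_nonneg (Real.sqrt_nonneg 2)]
    exact mul_le_of_le_one_right (Real.sqrt_nonneg 2) (Real.abs_cos_le_one _)

lemma continuous_chebProd (ν : ℕ →₀ ℕ) : Continuous (chebProd ν) := by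
  unfold chebProd
  exact continuous_finsetProd _ fun j _ => (continuous_chebFun _).comp (continuous_apply j)

lemma abs_chebProd_le (ν : ℕ →₀ ℕ) (y : ℕ → ℝ) :
    |chebProd ν y| ≤ Real.sqrt 2 ^ ν.support.card := by
  unfold chebProd
  rw [Finset.abs_prod, ← Finset.prod_const]
  refine Finset.prod_le_prod (fun _ _ => abs_nonneg _) fun j hj => ?_
  simpa [Finsupp.mem_support_iff.mp hj] using abs_chebFun_le (ν j) (y j)

/-- Truncation of a real number to `[-1, 1]`. -/
noncomputable def unitClip (t : ℝ) : ℝ := max (-1) (min 1 t)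

lemma continuous_unitClip : Continuous unitClip := by
  unfold unitClip; fun_prop

lemma abs_unitClip_le (t : ℝ) : |unitClip t| ≤ 1 := by
  unfold unitClip; exact abs_le.mpr ⟨by simp, by simp⟩

lemma unitClip_of_mem {t : ℝ} (h : t ∈ Set.Icc (-1 : ℝ) 1) : unitClip t = t := by
  unfold unitClip; rw [min_eq_right h.2, max_eq_right h.1]

lemma integral_chebMeasure (f : ℝ → ℝ) :
    ∫ t, f t ∂chebMeasure = Real.pi⁻¹ * ∫ θ in (0 : ℝ)..Real.pi, f (Real.cos θ) := by
  rw [← Polynomial.Chebyshev.integral_measureT_eq_integral_cos,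
    Polynomial.Chebyshev.integral_measureT, intervalIntegral.integral_of_le (by norm_num),
    integral_Ioc_eq_integral_Ioo, chebMeasure, ← integral_const_mul,
    integral_withDensity_eq_integral_toReal_smul (by fun_prop)
      (Eventually.of_forall fun _ => ENNReal.ofReal_lt_top)]
  refine integral_congr_ae (Eventually.of_forall fun t => ?_)
  have : 0 ≤ 1 / (Real.pi * Real.sqrt (1 - t ^ 2)) := by positivity
  simp only [ENNReal.toReal_ofReal this, smul_eq_mul, Real.sqrt_inv]
  rw [one_div, mul_inv]
  ring

lemma integral_cos_pow_mul_cos (m k : ℕ) (h : m < k) :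
    ∫ θ in (0 : ℝ)..Real.pi, Real.cos θ ^ m * Real.cos (k * θ) = 0 := by
  induction m generalizing k with
  | zero =>
    have hk : (k : ℝ) ≠ 0 := by exact_mod_cast h.ne'
    simp [intervalIntegral.integral_comp_mul_left _ hk]
  | succ m ih =>
    obtain ⟨k, rfl⟩ : ∃ l, k = l + 1 := ⟨k - 1, by omega⟩
    have key : ∀ θ : ℝ, Real.cos θ ^ (m + 1) * Real.cos ((k + 1 : ℕ) * θ) =
        (1 / 2) * (Real.cos θ ^ m * Real.cos ((k + 2 : ℕ) * θ)
          + Real.cos θ ^ m * Real.cos (k * θ)) := fun θ => by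
      have h1 : ((k + 2 : ℕ) : ℝ) * θ = (k + 1 : ℕ) * θ + θ := by push_cast; ring
      have h2 : (k : ℝ) * θ = (k + 1 : ℕ) * θ - θ := by push_cast; ring
      rw [h1, h2, Real.cos_add, Real.cos_sub]
      ring
    simp_rw [key]
    rw [intervalIntegral.integral_const_mul, intervalIntegral.integral_add
      (Continuous.intervalIntegrable (by fun_prop) _ _)
      (Continuous.intervalIntegrable (by fun_prop) _ _), ih _ (by omega), ih _ (by omega)]
    simp

lemma integral_chebFun_mul_pow_eq_zero {k m : ℕ} (h : m < k) :
    ∫ t, chebFun k t * unitClip t ^ m ∂chebMeasure = 0 := by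
  rw [integral_chebMeasure]
  have hk : k ≠ 0 := by omega
  have : ∫ θ in (0 : ℝ)..Real.pi, chebFun k (Real.cos θ) * unitClip (Real.cos θ) ^ m =
      ∫ θ in (0 : ℝ)..Real.pi, Real.sqrt 2 * (Real.cos θ ^ m * Real.cos (k * θ)) := by
    refine intervalIntegral.integral_congr fun θ hθ => ?_
    rw [Set.uIcc_of_le Real.pi_pos.le] at hθ
    simp only [chebFun, hk, if_false, Real.arccos_cos hθ.1 hθ.2,
      unitClip_of_mem ⟨Real.neg_one_le_cos θ, Real.cos_le_one θ⟩]
    ring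
  rw [this, intervalIntegral.integral_const_mul, integral_cos_pow_mul_cos m k h]
  simp

lemma abs_integral_chebFun_mul_pow_le [IsProbabilityMeasure chebMeasure] (k m : ℕ) {r : ℝ}
    (hr : 1 ≤ r) :
    |∫ t, chebFun k t * unitClip t ^ m ∂chebMeasure| ≤
      (if k = 0 then 1 else Real.sqrt 2) * (r ^ k)⁻¹ * r ^ m := by
  have hr0 : 0 < r := by linarith
  have hc : (0 : ℝ) ≤ if k = 0 then 1 else Real.sqrt 2 := by split_ifs <;> positivity
  rcases lt_or_ge m k with h | h
  · rw [integral_chebFun_mul_pow_eq_zero h, abs_zero]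
    positivity
  · have h1 : |∫ t, chebFun k t * unitClip t ^ m ∂chebMeasure| ≤
        if k = 0 then 1 else Real.sqrt 2 := by
      have := norm_integral_le_of_norm_le_const (μ := chebMeasure)
        (f := fun t => chebFun k t * unitClip t ^ m)
        (C := if k = 0 then 1 else Real.sqrt 2) (Eventually.of_forall fun t => by
          rw [norm_mul, norm_pow, Real.norm_eq_abs, Real.norm_eq_abs]
          calc _ ≤ (if k = 0 then 1 else Real.sqrt 2) * 1 :=
                mul_le_mul (abs_chebFun_le k t)
                  (pow_le_one₀ (abs_nonneg _) (abs_unitClip_le t)) (by positivity) hc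
            _ = _ := mul_one _)
      simpa using this
    refine h1.trans ?_
    rw [mul_assoc]
    refine le_mul_of_one_le_right hc ?_
    rw [inv_mul_eq_div, one_le_div (by positivity)]
    exact pow_le_pow_right₀ hr h

lemma IsChebProductMeasure.isProbabilityMeasure_chebMeasure {η : Measure (ℕ → ℝ)}
    (hη : IsChebProductMeasure η) : IsProbabilityMeasure chebMeasure := by
  have := hη.1
  have h := hη.2 {0} (fun _ => Set.univ) (fun _ => MeasurableSet.univ)
  exact ⟨by simpa using h.symm⟩

lemma IsChebProductMeasure.eq_infinitePi [IsProbabilityMeasure chebMeasure]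
    {η : Measure (ℕ → ℝ)} (hη : IsChebProductMeasure η) :
    η = Measure.infinitePi fun _ : ℕ => chebMeasure := by
  refine Measure.eq_infinitePi _ fun s t ht => ?_
  rw [← hη.2 s t ht]
  rfl

lemma IsChebProductMeasure.ae_mem_Icc {η : Measure (ℕ → ℝ)} (hη : IsChebProductMeasure η) :
    ∀ᵐ y ∂η, ∀ j, y j ∈ Set.Icc (-1 : ℝ) 1 := by
  rw [ae_all_iff]
  intro j
  have h0 : chebMeasure (Set.Icc (-1 : ℝ) 1)ᶜ = 0 := by
    refine withDensity_absolutelyContinuous _ _ ?_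
    rw [Measure.restrict_apply measurableSet_Icc.compl]
    convert measure_empty (μ := (volume : Measure ℝ))
    ext t
    simp only [Set.mem_inter_iff, Set.mem_compl_iff, Set.mem_Icc, Set.mem_Ioo,
      Set.mem_empty_iff_false, iff_false]
    rintro ⟨h, h1, h2⟩
    exact h ⟨h1.le, h2.le⟩
  have h := hη.2 {j} (fun _ => (Set.Icc (-1 : ℝ) 1)ᶜ) (fun _ => measurableSet_Icc.compl)
  rw [ae_iff]
  simpa [h0] using h

lemma IsChebProductMeasure.integral_prod {η : Measure (ℕ → ℝ)} (hη : IsChebProductMeasure η)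
    (s : Finset ℕ) (g : ℕ → ℝ → ℝ) (hg : ∀ i, Continuous (g i)) :
    ∫ y, ∏ i ∈ s, g i (y i) ∂η = ∏ i ∈ s, ∫ t, g i t ∂chebMeasure := by
  have := hη.isProbabilityMeasure_chebMeasure
  rw [hη.eq_infinitePi]
  have h := integral_restrict_infinitePi (fun _ : ℕ => chebMeasure) (s := s)
    (f := fun x => ∏ i : s, g i (x i))
    (Continuous.aestronglyMeasurable
      (continuous_finsetProd _ fun i _ => (hg i).comp (continuous_apply i)))
  rw [integral_fintype_prod_eq_prod (fun (i : s) t => g i t)] at h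
  rw [← Finset.prod_coe_sort s fun i => ∫ t, g i t ∂chebMeasure, ← h]
  refine integral_congr_ae (Eventually.of_forall fun y => ?_)
  exact (Finset.prod_coe_sort s fun i => g i (y i)).symm

/-- The monomial `∏ y_i` over the letters `i` of a word, with clipped coordinates. -/
noncomputable def clipMonomial (w : List ℕ) (y : ℕ → ℝ) : ℝ :=
  (w.map fun i => unitClip (y i)).prod

lemma clipMonomial_cons (i : ℕ) (w : List ℕ) (y : ℕ → ℝ) :
    clipMonomial (i :: w) y = unitClip (y i) * clipMonomial w y := by
  simp [clipMonomial]

lemma continuous_clipMonomial (w : List ℕ) : Continuous (clipMonomial w) :=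
  continuous_list_prod w fun i _ => continuous_unitClip.comp (continuous_apply i)

lemma abs_clipMonomial_le (w : List ℕ) (y : ℕ → ℝ) : |clipMonomial w y| ≤ 1 := by
  induction w with
  | nil => simp [clipMonomial]
  | cons i w ih =>
    rw [clipMonomial_cons, abs_mul]
    exact mul_le_one₀ (abs_unitClip_le _) (abs_nonneg _) ih

lemma abs_integral_chebProd_mul_clipMonomial_le {η : Measure (ℕ → ℝ)}
    (hη : IsChebProductMeasure η) (ν : ℕ →₀ ℕ) {ρ : ℕ → ℝ} (hρ : ∀ j, 1 ≤ ρ j) (w : List ℕ) :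
    |∫ y, chebProd ν y * clipMonomial w y ∂η| ≤
      Real.sqrt 2 ^ ν.support.card * (∏ j ∈ ν.support, ρ j ^ ν j)⁻¹ * (w.map ρ).prod := by
  have := hη.isProbabilityMeasure_chebMeasure
  set s := ν.support ∪ w.toFinset
  have hw : ∀ a : ℕ → ℝ, (w.map a).prod = ∏ i ∈ s, a i ^ w.count i := fun a => by
    rw [Finset.prod_list_map_count]
    refine Finset.prod_subset Finset.subset_union_right fun i _ hi => ?_
    rw [List.count_eq_zero_of_not_mem (by simpa using hi), pow_zero]
  have hν : ∀ a : ℕ → ℝ, (∀ i, ν i = 0 → a i = 1) → ∏ i ∈ ν.support, a i = ∏ i ∈ s, a i :=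
    fun a ha => Finset.prod_subset Finset.subset_union_left fun i _ hi =>
      ha i (by simpa using hi)
  have h1 : ∀ y, chebProd ν y * clipMonomial w y =
      ∏ i ∈ s, chebFun (ν i) (y i) * unitClip (y i) ^ w.count i := fun y => by
    rw [Finset.prod_mul_distrib, ← hw fun i => unitClip (y i), chebProd,
      hν _ fun i hi => by simp [chebFun, hi]]
    rfl
  simp_rw [h1]
  rw [hη.integral_prod s (fun i t => chebFun (ν i) t * unitClip t ^ w.count i)
    fun i => (continuous_chebFun _).mul (continuous_unitClip.pow _), Finset.abs_prod]
  have h2 : Real.sqrt 2 ^ ν.support.card = ∏ i ∈ s, if ν i = 0 then 1 else Real.sqrt 2 := by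
    rw [← hν _ fun i hi => by simp [hi], ← Finset.prod_const]
    exact Finset.prod_congr rfl fun i hi => by simp [Finsupp.mem_support_iff.mp hi]
  rw [h2, hw, hν (fun i => ρ i ^ ν i) fun i hi => by simp [hi], ← Finset.prod_inv_distrib,
    ← Finset.prod_mul_distrib, ← Finset.prod_mul_distrib]
  exact Finset.prod_le_prod (fun _ _ => abs_nonneg _) fun i _ =>
    abs_integral_chebFun_mul_pow_le _ _ (hρ i)

section Neumann

variable {E : Type*} [NormedAddCommGroup E] [NormedSpace ℝ E]

/-- The operator series `∑ y_j B_j` with coordinates clipped to `[-1, 1]`. -/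
noncomputable def clipSeries (B : ℕ → E →L[ℝ] E) (y : ℕ → ℝ) : E →L[ℝ] E :=
  ∑' j, unitClip (y j) • B j

lemma norm_unitClip_smul_le (B : ℕ → E →L[ℝ] E) (y : ℕ → ℝ) (j : ℕ) :
    ‖unitClip (y j) • B j‖ ≤ ‖B j‖ := by
  rw [norm_smul]
  exact mul_le_of_le_one_left (norm_nonneg _) (abs_unitClip_le _)

lemma hasSum_clipSeries [CompleteSpace E] {B : ℕ → E →L[ℝ] E}
    (hB : Summable fun j => ‖B j‖)
    (y : ℕ → ℝ) :
    HasSum (fun j => unitClip (y j) • B j) (clipSeries B y) :=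
  (Summable.of_norm_bounded hB (norm_unitClip_smul_le B y)).hasSum

lemma continuous_clipSeries [CompleteSpace E] {B : ℕ → E →L[ℝ] E}
    (hB : Summable fun j => ‖B j‖) : Continuous (clipSeries B) :=
  continuous_tsum (fun j => ((continuous_unitClip.comp (continuous_apply j)).smul
    continuous_const)) hB fun j y => norm_unitClip_smul_le B y j

lemma norm_clipSeries_le {B : ℕ → E →L[ℝ] E} (hB : Summable fun j => ‖B j‖)
    (y : ℕ → ℝ) : ‖clipSeries B y‖ ≤ ∑' j, ‖B j‖ :=
  tsum_of_norm_bounded hB.hasSum (norm_unitClip_smul_le B y)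

lemma norm_clipSeries_pow_apply_le {B : ℕ → E →L[ℝ] E} (hB : Summable fun j => ‖B j‖)
    (y : ℕ → ℝ) (n : ℕ) (g : E) :
    ‖(clipSeries B y ^ n) g‖ ≤ (∑' j, ‖B j‖) ^ n * ‖g‖ := by
  induction n generalizing g with
  | zero => simp
  | succ n ih =>
    rw [pow_succ, mul_apply_eq_comp, pow_succ, mul_assoc]
    refine (ih _).trans (mul_le_mul_of_nonneg_left ?_
      (pow_nonneg (tsum_nonneg fun _ => norm_nonneg _) _))
    exact (clipSeries B y).le_of_opNorm_le (norm_clipSeries_le hB y) g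

lemma continuous_clipSeries_pow_apply [CompleteSpace E] {B : ℕ → E →L[ℝ] E}
    (hB : Summable fun j => ‖B j‖)
    (n : ℕ) (g : E) :
    Continuous fun y => (clipSeries B y ^ n) g :=
  ((continuous_clipSeries hB).pow n).clm_apply continuous_const

lemma norm_integral_clipSeries_pow_le [CompleteSpace E] {B : ℕ → E →L[ℝ] E}
    (hB : Summable fun j => ‖B j‖)
    {η : Measure (ℕ → ℝ)} [IsProbabilityMeasure η]
    {φ : (ℕ → ℝ) → ℝ} (hφ : Continuous φ) {M : ℝ} (hM : ∀ y, |φ y| ≤ M)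
    {ρ : ℕ → ℝ} (hρ : ∀ j, 0 ≤ ρ j) (hsum : Summable fun j => ρ j * ‖B j‖) {C : ℝ}
    (hC : ∀ w, |∫ y, φ y * clipMonomial w y ∂η| ≤ C * (w.map ρ).prod)
    (n : ℕ) (w : List ℕ) (g : E) :
    ‖∫ y, (φ y * clipMonomial w y) • (clipSeries B y ^ n) g ∂η‖ ≤
      C * (w.map ρ).prod * (∑' j, ρ j * ‖B j‖) ^ n * ‖g‖ := by
  induction n generalizing w g with
  | zero =>
    simp only [pow_zero, one_apply_eq_self, mul_one]
    rw [integral_smul_const, norm_smul]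
    exact mul_le_mul_of_nonneg_right (hC w) (norm_nonneg _)
  | succ n ih =>
    have hq : 0 ≤ ∑' j, ρ j * ‖B j‖ :=
      tsum_nonneg fun j => mul_nonneg (hρ j) (norm_nonneg _)
    have hM0 : 0 ≤ M := (abs_nonneg _).trans (hM 0)
    set b := ∑' j, ‖B j‖
    have hb : 0 ≤ b := tsum_nonneg fun _ => norm_nonneg _
    set F : ℕ → (ℕ → ℝ) → E := fun j y =>
      (φ y * clipMonomial (j :: w) y) • (clipSeries B y ^ n) (B j g)
    have hFc : ∀ j, Continuous (F j) := fun j =>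
      (hφ.mul (continuous_clipMonomial _)).smul (continuous_clipSeries_pow_apply hB n _)
    have hFb : ∀ j y, ‖F j y‖ ≤ M * (b ^ n * ‖g‖) * ‖B j‖ := fun j y => by
      rw [norm_smul, norm_mul]
      calc _ ≤ (M * 1) * (b ^ n * (‖B j‖ * ‖g‖)) := by
            refine mul_le_mul (mul_le_mul (hM y) (abs_clipMonomial_le _ _) (norm_nonneg _) hM0)
              ((norm_clipSeries_pow_apply_le hB y n _).trans ?_) (norm_nonneg _) (by positivity)
            exact mul_le_mul_of_nonneg_left ((B j).le_opNorm g) (by positivity)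
        _ = _ := by ring
    have hFi : ∀ j, Integrable (F j) η := fun j =>
      Integrable.of_bound (hFc j).aestronglyMeasurable _ (Eventually.of_forall (hFb j))
    have hFs : Summable fun j => ∫ y, ‖F j y‖ ∂η := by
      refine Summable.of_nonneg_of_le (fun j => integral_nonneg fun _ => norm_nonneg _)
        (fun j => ?_) (hB.mul_left (M * (b ^ n * ‖g‖)))
      have := integral_mono (hFi j).norm (integrable_const _) (hFb j)
      simpa using this
    have hpt : ∀ y, HasSum (fun j => F j y)
        ((φ y * clipMonomial w y) • (clipSeries B y ^ (n + 1)) g) := fun y => by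
      have h1 := (hasSum_clipSeries hB y).mapL (ContinuousLinearMap.apply ℝ E g)
      have h2 := (h1.mapL (clipSeries B y ^ n)).const_smul (φ y * clipMonomial w y)
      rw [pow_succ, mul_apply_eq_comp]
      refine h2.congr_fun fun j => ?_
      simp only [F, clipMonomial_cons, ContinuousLinearMap.apply_apply, map_smul,
        smul_smul]
      congr 1
      ring
    have hInt := hasSum_integral_of_summable_integral_norm hFi hFs
    simp_rw [fun y => (hpt y).tsum_eq] at hInt
    rw [← hInt.tsum_eq]
    have hbd : ∀ j, ‖∫ y, F j y ∂η‖ ≤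
        (C * (w.map ρ).prod * (∑' j, ρ j * ‖B j‖) ^ n * ‖g‖) * (ρ j * ‖B j‖) := fun j => by
      have hj : 0 ≤ C * ((j :: w).map ρ).prod := (abs_nonneg _).trans (hC _)
      calc _ ≤ C * ((j :: w).map ρ).prod * (∑' j, ρ j * ‖B j‖) ^ n * ‖B j g‖ := ih _ _
        _ ≤ C * ((j :: w).map ρ).prod * (∑' j, ρ j * ‖B j‖) ^ n * (‖B j‖ * ‖g‖) :=
          mul_le_mul_of_nonneg_left ((B j).le_opNorm g) (mul_nonneg hj (pow_nonneg hq _))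
        _ = _ := by rw [List.map_cons, List.prod_cons]; ring
    refine (tsum_of_norm_bounded (hsum.hasSum.mul_left _) hbd).trans (le_of_eq ?_)
    ring

lemma hasSum_clipSeries_pow_apply [CompleteSpace E] {B : ℕ → E →L[ℝ] E}
    (hB : Summable fun j => ‖B j‖)
    (hb : ∑' j, ‖B j‖ < 1) (y : ℕ → ℝ) {g x : E}
    (hx : x - clipSeries B y x = g) : HasSum (fun n => (clipSeries B y ^ n) g) x := by
  have hlt : ‖clipSeries B y‖ < 1 := (norm_clipSeries_le hB y).trans_lt hb
  have h1 := (summable_geometric_of_norm_lt_one hlt).hasSum.mapL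
    (ContinuousLinearMap.apply ℝ E g)
  have h2 := congrArg (fun L : E →L[ℝ] E => L x) (geom_series_mul_neg _ hlt)
  simp only [mul_apply_eq_comp, sub_apply,
    one_apply_eq_self, hx] at h2
  simpa [h2] using h1

end Neumann

/-- bound for the tensorized Chebyshev coefficients of the parametric solution.
If `ρ ≥ 1` is δ-admissible, then for every finitely supported multi-index `ν` the function
`y ↦ T_ν(y) u(y)` is Bochner integrable w.r.t. the product Chebyshev measure `η` and
`‖d_ν‖ = ‖∫ T_ν(y) u(y) dη(y)‖ ≤ (δ μ0)⁻¹ ‖f‖ 2^{‖ν‖₀/2} ρ^{-ν}`. -/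
theorem stmt7
    {X Y : Type*} [NormedAddCommGroup X] [NormedSpace ℂ X] [CompleteSpace X]
    [NormedAddCommGroup Y] [NormedSpace ℂ Y] [CompleteSpace Y]
    (A0 : X →L[ℂ] Y) (A0inv : Y →L[ℂ] X)
    (hleft : ∀ x, A0inv (A0 x) = x) (hright : ∀ w, A0 (A0inv w) = w)
    (μ0 : ℝ) (hμ0 : 0 < μ0) (hA0inv : ‖A0inv‖ ≤ 1 / μ0)
    (A : ℕ → X →L[ℂ] Y) (δ : ℝ) (hδ0 : 0 < δ) (hδ1 : δ < 1)
    (ρ : ℕ → ℝ) (hρ : ∀ j, 1 ≤ ρ j)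
    (hsum : Summable fun j => ρ j * ‖A0inv.comp (A j)‖)
    (hadm : (∑' j, ρ j * ‖A0inv.comp (A j)‖) ≤ 1 - δ)
    (η : Measure (ℕ → ℝ)) (hη : IsChebProductMeasure η)
    (f : Y) (u : (ℕ → ℝ) → X)
    (hu : ∀ y : ℕ → ℝ, (∀ j, y j ∈ Set.Icc (-1 : ℝ) 1) →
      ∃ S : X →L[ℂ] Y, HasSum (fun j => (y j : ℂ) • A j) S ∧ (A0 + S) (u y) = f)
    (ν : ℕ →₀ ℕ) :
    Integrable (fun y => chebProd ν y • u y) η ∧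
    ‖∫ y, chebProd ν y • u y ∂η‖ ≤
      (δ * μ0)⁻¹ * ‖f‖ * Real.sqrt 2 ^ ν.support.card *
        (∏ j ∈ ν.support, ρ j ^ ν j)⁻¹ := by
  have hprob := hη.1
  set B : ℕ → X →L[ℝ] X := fun j => (-(A0inv.comp (A j))).restrictScalars ℝ with hBdef
  have hBn : ∀ j, ‖B j‖ = ‖A0inv.comp (A j)‖ := fun j => by
    simp [hBdef, ContinuousLinearMap.norm_restrictScalars]
  simp_rw [← hBn] at hsum hadm
  have hle : ∀ j, ‖B j‖ ≤ ρ j * ‖B j‖ := fun j => le_mul_of_one_le_left (norm_nonneg _) (hρ j)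
  have hB : Summable fun j => ‖B j‖ := Summable.of_nonneg_of_le (fun _ => norm_nonneg _) hle hsum
  have hb : ∑' j, ‖B j‖ ≤ 1 - δ := (hB.tsum_le_tsum hle hsum).trans hadm
  have hb1 : ∑' j, ‖B j‖ < 1 := by linarith
  set b := ∑' j, ‖B j‖
  have hb0 : 0 ≤ b := tsum_nonneg fun _ => norm_nonneg _
  set q := ∑' j, ρ j * ‖B j‖
  have hq0 : 0 ≤ q := hb0.trans (hB.tsum_le_tsum hle hsum)
  set g := A0inv f
  have hg : ‖g‖ ≤ μ0⁻¹ * ‖f‖ := by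
    simpa using A0inv.le_of_opNorm_le hA0inv f
  have hu' : ∀ᵐ y ∂η, HasSum (fun n => (clipSeries B y ^ n) g) (u y) := by
    filter_upwards [hη.ae_mem_Icc] with y hy
    obtain ⟨S, hS, hSu⟩ := hu y hy
    refine hasSum_clipSeries_pow_apply hB hb1 y ?_
    have h1 : HasSum (fun j => (unitClip (y j) • B j) (u y)) (clipSeries B y (u y)) :=
      (hasSum_clipSeries hB y).mapL (ContinuousLinearMap.apply ℝ X (u y))
    have h2 : HasSum (fun j => A0inv (((y j : ℂ) • A j) (u y))) (A0inv (S (u y))) :=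
      (hS.mapL (ContinuousLinearMap.apply ℂ Y (u y))).mapL A0inv
    have h3 : clipSeries B y (u y) = -A0inv (S (u y)) := by
      refine h1.unique (h2.neg.congr_fun fun j => ?_)
      simp [hBdef, unitClip_of_mem (hy j)]
    rw [h3, sub_neg_eq_add]
    simpa [hleft] using congrArg A0inv hSu
  have hF : ∀ n y, ‖chebProd ν y • (clipSeries B y ^ n) g‖ ≤
      Real.sqrt 2 ^ ν.support.card * (b ^ n * ‖g‖) := fun n y => by
    rw [norm_smul]
    exact mul_le_mul (abs_chebProd_le ν y) (norm_clipSeries_pow_apply_le hB y n g)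
      (norm_nonneg _) (by positivity)
  have hFi : ∀ n, Integrable (fun y => chebProd ν y • (clipSeries B y ^ n) g) η := fun n =>
    Integrable.of_bound ((continuous_chebProd ν).smul
      (continuous_clipSeries_pow_apply hB n g)).aestronglyMeasurable _
      (Eventually.of_forall (hF n))
  have hgeo : Summable fun n => Real.sqrt 2 ^ ν.support.card * (b ^ n * ‖g‖) :=
    ((summable_geometric_of_lt_one hb0 hb1).mul_right _).mul_left _
  have hFs : Summable fun n => ∫ y, ‖chebProd ν y • (clipSeries B y ^ n) g‖ ∂η := by
    refine Summable.of_nonneg_of_le (fun n => integral_nonneg fun _ => norm_nonneg _)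
      (fun n => ?_) hgeo
    simpa using integral_mono (hFi n).norm (integrable_const _) (hF n)
  have hsumae : ∀ᵐ y ∂η,
      ∑' n, chebProd ν y • (clipSeries B y ^ n) g = chebProd ν y • u y := by
    filter_upwards [hu'] with y hy
    exact (hy.const_smul _).tsum_eq
  refine ⟨?_, ?_⟩
  · have hInt : Integrable (fun y => ∑' n, chebProd ν y • (clipSeries B y ^ n) g) η := by
      refine Integrable.of_bound (Continuous.aestronglyMeasurable (continuous_tsum (fun n =>
        (continuous_chebProd ν).smul (continuous_clipSeries_pow_apply hB n g)) hgeo hF))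
        (∑' n, Real.sqrt 2 ^ ν.support.card * (b ^ n * ‖g‖)) (Eventually.of_forall fun y => ?_)
      exact tsum_of_norm_bounded hgeo.hasSum (hF · y)
    exact hInt.congr hsumae
  · rw [← integral_congr_ae hsumae,
      ← (hasSum_integral_of_summable_integral_norm hFi hFs).tsum_eq]
    set C := Real.sqrt 2 ^ ν.support.card * (∏ j ∈ ν.support, ρ j ^ ν j)⁻¹ with hCdef
    have hC0 : 0 ≤ C := mul_nonneg (by positivity) (inv_nonneg.mpr (Finset.prod_nonneg
      fun j _ => pow_nonneg (zero_le_one.trans (hρ j)) _))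
    have hterm : ∀ n, ‖∫ y, chebProd ν y • (clipSeries B y ^ n) g ∂η‖ ≤ C * ‖g‖ * q ^ n :=
      fun n => by
        have := norm_integral_clipSeries_pow_le hB (η := η) (continuous_chebProd ν)
          (abs_chebProd_le ν) (fun j => zero_le_one.trans (hρ j)) hsum
          (abs_integral_chebProd_mul_clipMonomial_le hη ν hρ) n [] g
        simp only [clipMonomial, List.map_nil, List.prod_nil, mul_one] at this
        exact this.trans (le_of_eq (by ring))
    refine (tsum_of_norm_bounded
      ((hasSum_geometric_of_lt_one hq0 (by linarith)).mul_left (C * ‖g‖)) hterm).trans ?_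
    calc C * ‖g‖ * (1 - q)⁻¹ ≤ C * (μ0⁻¹ * ‖f‖) * δ⁻¹ := by
          refine mul_le_mul (mul_le_mul_of_nonneg_left hg hC0)
            (inv_anti₀ hδ0 (by linarith)) (inv_nonneg.mpr (by linarith)) (by positivity)
      _ = _ := by rw [hCdef, mul_inv]; ring
end

section
/- Let X be a complex Banach space, let ρ > 1, and let g : ℂ → X be differentiable on the open disc { z ∈ ℂ : |z| < ρ } with ‖g(z)‖_X ≤ M for all |z| < ρ. Then for every integer n ≥ 1, the Bochner integral of g against the normalized Chebyshev weight satisfies ‖∫_{-1}^{1} g(t) T_n(t) dt/(π√(1-t²))‖_X ≤ √2 · M · ρ^{-n}, where T_n(t) = √2 cos(n arccos t). -/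
open MeasureTheory

/-- The substitution `t = cos θ` in integrals against the Chebyshev weight. -/
lemma integral_chebyshev_weight_eq {X : Type*} [NormedAddCommGroup X] [NormedSpace ℂ X]
    (f : ℝ → X) (c : ℝ) (n : ℕ) :
    ∫ t in Set.Ioo (-1 : ℝ) 1,
        ((c * Real.cos (n * Real.arccos t)) / (Real.pi * Real.sqrt (1 - t ^ 2))) • f t =
      (c / Real.pi) • ∫ θ in 0..Real.pi, Real.cos (n * θ) • f (Real.cos θ) := by
  have himage : Real.cos '' Set.Ioo 0 Real.pi = Set.Ioo (-1) 1 :=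
    Real.cosPartialHomeomorph.image_source_eq_target
  rw [← himage, integral_image_eq_integral_abs_deriv_smul measurableSet_Ioo
    (fun θ _ => (Real.hasDerivAt_cos θ).hasDerivWithinAt)
    (Real.injOn_cos.mono Set.Ioo_subset_Icc_self),
    intervalIntegral.integral_of_le Real.pi_pos.le, integral_Ioc_eq_integral_Ioo, ← integral_smul]
  refine setIntegral_congr_fun measurableSet_Ioo fun θ hθ => ?_
  have hs : 0 < Real.sin θ := Real.sin_pos_of_mem_Ioo hθ
  have hsq : Real.sqrt (1 - Real.cos θ ^ 2) = Real.sin θ := by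
    rw [← Real.abs_sin_eq_sqrt_one_sub_cos_sq, abs_of_pos hs]
  simp only [abs_neg, abs_of_pos hs, hsq, Real.arccos_cos hθ.1.le hθ.2.le, smul_smul]
  congr 1
  field_simp

/-- The cosine coefficient of an even function of `θ` is a coefficient of its Laurent expansion. -/
lemma circleIntegral_joukowski {X : Type*} [NormedAddCommGroup X] [NormedSpace ℂ X]
    (g : ℂ → X) (hg : Continuous fun θ : ℝ => g (Real.cos θ)) (n : ℕ) :
    (2 * Real.pi * Complex.I : ℂ)⁻¹ •
        ∮ w in C(0, 1), (w ^ (n + 1))⁻¹ • g ((w + w⁻¹) / 2) =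
      (1 / Real.pi : ℝ) • ∫ θ in 0..Real.pi, Real.cos (n * θ) • g (Real.cos θ) := by
  set F : ℝ → X := fun θ => Complex.exp (-(n * θ * Complex.I)) • g (Real.cos θ) with hF
  have hFc : Continuous F := Continuous.smul (by fun_prop) hg
  have hFn : Continuous fun θ => F (-θ) := hFc.comp continuous_neg
  have hper : Function.Periodic F (2 * Real.pi) := by
    intro θ
    simp only [hF, Real.cos_add_two_pi]
    congr 1
    rw [Complex.exp_eq_exp_iff_exists_int]
    refine ⟨-n, ?_⟩
    push_cast
    ring
  have h1 : (∮ w in C(0, 1), (w ^ (n + 1))⁻¹ • g ((w + w⁻¹) / 2)) =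
      Complex.I • ∫ θ in 0..(2 * Real.pi), F θ := by
    rw [circleIntegral, ← intervalIntegral.integral_smul]
    refine intervalIntegral.integral_congr fun θ _ => ?_
    have hc : (circleMap 0 1 θ + (circleMap 0 1 θ)⁻¹) / 2 = (Real.cos θ : ℂ) := by
      simp [circleMap, Complex.cos, Complex.exp_neg]
    simp only [hF, hc, smul_smul, deriv_circleMap]
    congr 1
    simp only [circleMap, Complex.ofReal_one, one_mul, zero_add, ← Complex.exp_nat_mul,
      ← Complex.exp_neg]
    rw [mul_comm _ Complex.I, mul_assoc, ← Complex.exp_add]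
    congr 2
    push_cast
    ring
  have h2 : ∫ θ in 0..(2 * Real.pi), F θ =
      (2 : ℝ) • ∫ θ in 0..Real.pi, Real.cos (n * θ) • g (Real.cos θ) := by
    have h3 := hper.intervalIntegral_add_eq 0 (-Real.pi)
    rw [zero_add, show -Real.pi + 2 * Real.pi = Real.pi by ring] at h3
    rw [h3, ← intervalIntegral.integral_add_adjacent_intervals (b := 0)
      (hFc.intervalIntegrable _ _) (hFc.intervalIntegrable _ _)]
    have h4 : ∫ θ in (-Real.pi)..0, F θ = ∫ θ in 0..Real.pi, F (-θ) := by
      rw [intervalIntegral.integral_comp_neg, neg_zero]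
    rw [h4, ← intervalIntegral.integral_add
      (hFn.intervalIntegrable _ _) (hFc.intervalIntegrable _ _),
      ← intervalIntegral.integral_smul]
    refine intervalIntegral.integral_congr fun θ _ => ?_
    simp only [hF, Real.cos_neg, ← add_smul, smul_smul, ← Complex.coe_smul]
    congr 1
    simp only [Complex.ofReal_mul, Complex.ofReal_cos, Complex.cos]
    push_cast
    ring_nf
  rw [h1, h2, ← Complex.coe_smul, ← Complex.coe_smul, smul_smul, smul_smul]
  congr 1
  have := Real.pi_ne_zero
  push_cast
  field_simp

/-- The Joukowski map sends the annulus `1 ≤ |w| ≤ ρ` into the open disc of radius `ρ`. -/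
lemma joukowski_mem_ball {ρ : ℝ} (hρ : 1 < ρ) {w : ℂ} (h1 : 1 ≤ ‖w‖) (h2 : ‖w‖ ≤ ρ) :
    (w + w⁻¹) / 2 ∈ Metric.ball (0 : ℂ) ρ := by
  have h3 : ‖w + w⁻¹‖ ≤ ‖w‖ + ‖w‖⁻¹ := by simpa using norm_add_le w w⁻¹
  have h4 : ‖w‖⁻¹ ≤ 1 := inv_le_one_of_one_le₀ h1
  rw [mem_ball_zero_iff, norm_div, Complex.norm_two]
  linarith

/-- Cauchy-type estimate for Chebyshev coefficients. If `g : ℂ → X` is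
holomorphic on the open disc of radius `ρ > 1` and bounded there by `M`, then for every
`n ≥ 1` the Bochner integral of `g` on `[-1,1]` against the normalized Chebyshev weight
satisfies `‖∫ g(t) T_n(t) dt/(π√(1-t²))‖ ≤ √2 M ρ^{-n}`, with `T_n(t) = √2 cos(n arccos t)`. -/
theorem stmt8 {X : Type*} [NormedAddCommGroup X] [NormedSpace ℂ X] [CompleteSpace X]
    (ρ : ℝ) (hρ : 1 < ρ) (g : ℂ → X) (M : ℝ)
    (hdiff : DifferentiableOn ℂ g (Metric.ball (0 : ℂ) ρ))
    (hbound : ∀ z ∈ Metric.ball (0 : ℂ) ρ, ‖g z‖ ≤ M)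
    (n : ℕ) (hn : 1 ≤ n) :
    ‖∫ t in Set.Ioo (-1 : ℝ) 1,
        ((Real.sqrt 2 * Real.cos (n * Real.arccos t)) / (Real.pi * Real.sqrt (1 - t ^ 2))) •
          g (t : ℂ)‖ ≤ Real.sqrt 2 * M * (ρ ^ n)⁻¹ := by
  have hρ0 : 0 < ρ := by linarith
  have hcos : Continuous fun θ : ℝ => g (Real.cos θ) := by
    refine hdiff.continuousOn.comp_continuous (by fun_prop) fun θ => ?_
    rw [mem_ball_zero_iff, Complex.norm_real, Real.norm_eq_abs]
    exact (Real.abs_cos_le_one θ).trans_lt hρ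
  have hf : ∀ w : ℂ, 1 ≤ ‖w‖ → ‖w‖ ≤ ρ →
      DifferentiableAt ℂ (fun w => (w ^ (n + 1))⁻¹ • g ((w + w⁻¹) / 2)) w := by
    intro w h1 h2
    have hw : w ≠ 0 := norm_pos_iff.1 (by linarith)
    have hJ : DifferentiableAt ℂ (fun w : ℂ => (w + w⁻¹) / 2) w :=
      (differentiableAt_id.add (differentiableAt_inv hw)).div_const 2
    have hg := (hdiff.differentiableAt
      (Metric.isOpen_ball.mem_nhds (joukowski_mem_ball hρ h1 h2))).comp w hJ
    exact ((differentiableAt_id.pow (n + 1)).inv (pow_ne_zero _ hw)).smul hg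
  have hshift : (∮ w in C(0, ρ), (w ^ (n + 1))⁻¹ • g ((w + w⁻¹) / 2)) =
      ∮ w in C(0, 1), (w ^ (n + 1))⁻¹ • g ((w + w⁻¹) / 2) := by
    refine Complex.circleIntegral_eq_of_differentiable_on_annulus_off_countable one_pos hρ.le
      Set.countable_empty (fun w hw => ?_) fun w hw => ?_
    · simp only [Set.mem_sdiff, mem_closedBall_zero_iff, mem_ball_zero_iff, not_lt] at hw
      exact (hf w hw.2 hw.1).continuousAt.continuousWithinAt
    · simp only [Set.mem_sdiff, mem_closedBall_zero_iff, mem_ball_zero_iff, not_le,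
        Set.mem_empty_iff_false, not_false_eq_true, and_true] at hw
      exact hf w hw.2.le hw.1.le
  have hle := circleIntegral.norm_two_pi_i_inv_smul_integral_le_of_norm_le_const
    (c := 0) (f := fun w => (w ^ (n + 1))⁻¹ • g ((w + w⁻¹) / 2)) (C := (ρ ^ (n + 1))⁻¹ * M)
    hρ0.le fun w hw => by
      rw [mem_sphere_zero_iff_norm] at hw
      rw [norm_smul, norm_inv, norm_pow, hw]
      gcongr
      exact hbound _ (joukowski_mem_ball hρ (by linarith) hw.le)
  rw [hshift, circleIntegral_joukowski g hcos] at hle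
  rw [integral_chebyshev_weight_eq (fun t : ℝ => g t), div_eq_mul_one_div, mul_smul, norm_smul,
    Real.norm_of_nonneg (Real.sqrt_nonneg 2), mul_assoc]
  refine mul_le_mul_of_nonneg_left (hle.trans_eq ?_) (Real.sqrt_nonneg 2)
  field_simp
  ring
end

section
/- Let 0 < p ≤ 1 and let a = (a_j)_{j≥1} be a sequence of nonnegative real numbers. Then ∑_{ν ∈ F} ( (|ν|!/ν!) · ∏_{j≥1} a_j^{ν_j} )^p < ∞ if and only if ∑_{j≥1} a_j < 1 and ∑_{j≥1} a_j^p < ∞. -/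
/-- The term `(|ν|!/ν!) aᵛ` of the multinomial expansion. -/
noncomputable def multinomialTerm {ι : Type*} (a : ι → ℝ) (ν : ι →₀ ℕ) : ℝ :=
  ((Nat.factorial ν.degree : ℝ) / ν.prod fun _ n => (Nat.factorial n : ℝ)) *
    ν.prod fun j n => a j ^ n

namespace multinomialTerm

variable {ι : Type*}

theorem prod_factorial_pos (ν : ι →₀ ℕ) : 0 < ν.prod fun _ n => (Nat.factorial n : ℝ) :=
  Finset.prod_pos fun _ _ => by positivity

theorem eq_multinomial_mul (a : ι → ℝ) (ν : ι →₀ ℕ) :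
    multinomialTerm a ν = (Nat.multinomial ν.support ν : ℝ) * ν.prod fun j n => a j ^ n := by
  have h := congrArg (Nat.cast (R := ℝ)) (Nat.multinomial_spec ν.support ν)
  push_cast at h
  have hpos := prod_factorial_pos ν
  rw [multinomialTerm, Finsupp.degree_apply, ← h]
  rw [Finsupp.prod] at hpos ⊢
  rw [mul_div_cancel_left₀ _ hpos.ne']

theorem nonneg {a : ι → ℝ} (ha : ∀ j, 0 ≤ a j) (ν : ι →₀ ℕ) : 0 ≤ multinomialTerm a ν := by
  rw [eq_multinomial_mul]
  exact mul_nonneg (Nat.cast_nonneg _) (Finset.prod_nonneg fun j _ => pow_nonneg (ha j) _)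

theorem single (a : ι → ℝ) (j : ι) : multinomialTerm a (Finsupp.single j 1) = a j := by
  simp [multinomialTerm]

theorem add_of_disjoint (a : ι → ℝ) {μ κ : ι →₀ ℕ} (h : Disjoint μ.support κ.support) :
    multinomialTerm a (μ + κ) = ((μ.degree + κ.degree).choose μ.degree : ℝ) *
      multinomialTerm a μ * multinomialTerm a κ := by
  classical
  have hμ := (prod_factorial_pos μ).ne'
  have hκ := (prod_factorial_pos κ).ne'
  have hc := congrArg (Nat.cast (R := ℝ)) (Nat.add_choose_mul_factorial_mul_factorial
    μ.degree κ.degree)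
  push_cast at hc
  rw [← Nat.choose_symm_add] at hc
  simp only [multinomialTerm]
  rw [Finsupp.prod_add_index_of_disjoint h, Finsupp.prod_add_index_of_disjoint h, map_add, ← hc]
  field_simp

theorem const_mul (t : ℝ) (a : ι → ℝ) (ν : ι →₀ ℕ) :
    multinomialTerm (fun j => t * a j) ν = t ^ ν.degree * multinomialTerm a ν := by
  simp only [multinomialTerm, Finsupp.prod, mul_pow, Finset.prod_mul_distrib,
    Finset.prod_pow_eq_pow_sum, Finsupp.degree_apply]
  ring

theorem congr {a b : ι → ℝ} {ν : ι →₀ ℕ} (h : ∀ j ∈ ν.support, a j = b j) :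
    multinomialTerm a ν = multinomialTerm b ν := by
  rw [multinomialTerm, multinomialTerm]
  congr 1
  exact Finset.prod_congr rfl fun j hj => by simp only [h j hj]

theorem rpow_le {p : ℝ} (hp1 : p ≤ 1) {a : ι → ℝ} (ha : ∀ j, 0 ≤ a j) (ν : ι →₀ ℕ) :
    multinomialTerm a ν ^ p ≤ multinomialTerm (fun j => a j ^ p) ν := by
  have hm : (1 : ℝ) ≤ Nat.multinomial ν.support ν := mod_cast Nat.multinomial_pos _ _
  rw [eq_multinomial_mul, eq_multinomial_mul, Finsupp.prod, Finsupp.prod,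
    Real.mul_rpow (by positivity) (Finset.prod_nonneg fun j _ => pow_nonneg (ha j) _),
    ← Real.finsetProd_rpow _ _ fun j _ => pow_nonneg (ha j) _]
  refine mul_le_mul (Real.rpow_le_self_of_one_le hm hp1) (le_of_eq ?_)
    (Finset.prod_nonneg fun j _ => Real.rpow_nonneg (pow_nonneg (ha j) _) _) (by positivity)
  refine Finset.prod_congr rfl fun j _ => ?_
  rw [← Real.rpow_natCast, ← Real.rpow_natCast, ← Real.rpow_mul (ha j), ← Real.rpow_mul (ha j),
    mul_comm]

theorem sum_finsuppAntidiag [DecidableEq ι] (a : ι → ℝ) (s : Finset ι) (n : ℕ) :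
    ∑ ν ∈ s.finsuppAntidiag n, multinomialTerm a ν = (∑ j ∈ s, a j) ^ n := by
  rw [Finset.sum_pow_eq_sum_piAntidiag, Finset.finsuppAntidiag, Finset.sum_map,
    ← Finset.sum_attach (s.piAntidiag n)]
  refine Finset.sum_congr rfl fun f _ => ?_
  have hs := (Finset.mem_piAntidiag.1 f.2).2
  rw [eq_multinomial_mul, ← Finsupp.multinomial_eq, Finsupp.multinomial_eq_of_support_subset
    (s := s) (by simp), Finsupp.prod_of_support_subset _ (s := s) (by simp) _ (by simp)]
  rfl

theorem le_sum_pow {a : ι → ℝ} (ha : ∀ j, 0 ≤ a j) {s : Finset ι} {ν : ι →₀ ℕ}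
    (h : ν.support ⊆ s) : multinomialTerm a ν ≤ (∑ j ∈ s, a j) ^ ν.degree := by
  classical
  rw [← sum_finsuppAntidiag]
  exact Finset.single_le_sum (fun ν _ => nonneg ha ν)
    (Finset.mem_finsuppAntidiag'.2 ⟨rfl, h⟩)

theorem pairwiseDisjoint_finsuppAntidiag [DecidableEq ι] (s : Finset ι) (t : Set ℕ) :
    t.PairwiseDisjoint fun n => s.finsuppAntidiag n := fun m _ n _ hmn => by
  refine Finset.disjoint_left.2 fun ν hm hn => hmn ?_
  rw [← (Finset.mem_finsuppAntidiag.1 hm).1, ← (Finset.mem_finsuppAntidiag.1 hn).1]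

theorem summable {a : ι → ℝ} (ha : ∀ j, 0 ≤ a j) {q : ℝ} (hq : q < 1)
    (h : ∀ s : Finset ι, ∑ j ∈ s, a j ≤ q) : Summable (multinomialTerm a) := by
  classical
  have hq0 : 0 ≤ q := by simpa using h ∅
  refine summable_of_sum_le (c := (1 - q)⁻¹) (nonneg ha) fun T => ?_
  let s := T.sup Finsupp.support
  let N := T.sup Finsupp.degree + 1
  have hT : T ⊆ (Finset.range N).biUnion fun n => s.finsuppAntidiag n := fun ν hν => by
    refine Finset.mem_biUnion.2 ⟨ν.degree, ?_, Finset.mem_finsuppAntidiag'.2 ⟨rfl, ?_⟩⟩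
    · exact Finset.mem_range.2 (Nat.lt_succ_of_le (Finset.le_sup (f := Finsupp.degree) hν))
    · exact Finset.le_sup (f := Finsupp.support) hν
  calc ∑ ν ∈ T, multinomialTerm a ν
      ≤ ∑ n ∈ Finset.range N, ∑ ν ∈ s.finsuppAntidiag n, multinomialTerm a ν := by
        rw [← Finset.sum_biUnion (pairwiseDisjoint_finsuppAntidiag s _)]
        exact Finset.sum_le_sum_of_subset_of_nonneg hT fun ν _ _ => nonneg ha ν
    _ ≤ ∑ n ∈ Finset.range N, q ^ n := by
        refine Finset.sum_le_sum fun n _ => ?_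
        rw [sum_finsuppAntidiag]
        exact pow_le_pow_left₀ (Finset.sum_nonneg fun j _ => ha j) (h s) n
    _ ≤ (1 - q)⁻¹ := by
        rw [← tsum_geometric_of_lt_one hq0 hq]
        exact (summable_geometric_of_lt_one hq0 hq).sum_le_tsum _ fun n _ => pow_nonneg hq0 n

theorem tsum_lt_one {a : ι → ℝ} (ha : ∀ j, 0 ≤ a j) (h : Summable (multinomialTerm a))
    (hsum : Summable a) : ∑' j, a j < 1 := by
  classical
  by_contra! hge
  have hbound (N : ℕ) : (N : ℝ) ≤ ∑' ν, multinomialTerm a ν := by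
    have hle (s : Finset ι) :
        ∑ n ∈ Finset.range N, (∑ j ∈ s, a j) ^ n ≤ ∑' ν, multinomialTerm a ν := by
      simp_rw [← sum_finsuppAntidiag]
      rw [← Finset.sum_biUnion (pairwiseDisjoint_finsuppAntidiag s _)]
      exact h.sum_le_tsum _ fun ν _ => nonneg ha ν
    have hlim := le_of_tendsto
      (tendsto_finsetSum (Finset.range N) fun n _ => hsum.hasSum.pow n) (.of_forall hle)
    calc (N : ℝ) = ∑ n ∈ Finset.range N, (1 : ℝ) := by simp
      _ ≤ ∑ n ∈ Finset.range N, (∑' j, a j) ^ n :=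
        Finset.sum_le_sum fun n _ => one_le_pow₀ hge
      _ ≤ _ := hlim
  obtain ⟨N, hN⟩ := exists_nat_gt (∑' ν, multinomialTerm a ν)
  exact (hbound N).not_gt hN

end multinomialTerm

/-- A product of finitely many geometric series is summable. -/
theorem summable_pow_sum_of_lt_one {κ : Type*} [Fintype κ] {q : ℝ} (hq0 : 0 ≤ q) (hq : q < 1) :
    Summable fun μ : κ → ℕ => q ^ ∑ i, μ i := by
  classical
  refine summable_of_sum_le (c := ∏ _i : κ, (1 - q)⁻¹) (fun _ => pow_nonneg hq0 _) fun T => ?_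
  let N := T.sup (fun μ => ∑ i, μ i) + 1
  have hT : T ⊆ Fintype.piFinset fun _ => Finset.range N := fun μ hμ =>
    Fintype.mem_piFinset.2 fun i => Finset.mem_range.2 <| Nat.lt_succ_of_le <|
      (Finset.single_le_sum (fun _ _ => Nat.zero_le _) (Finset.mem_univ i)).trans
        (Finset.le_sup (f := fun μ : κ → ℕ => ∑ i, μ i) hμ)
  calc ∑ μ ∈ T, q ^ ∑ i, μ i
      ≤ ∑ μ ∈ Fintype.piFinset fun _ : κ => Finset.range N, ∏ i, q ^ μ i := by
        simp_rw [Finset.prod_pow_eq_pow_sum]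
        exact Finset.sum_le_sum_of_subset_of_nonneg hT fun _ _ _ => pow_nonneg hq0 _
    _ = ∏ _i : κ, ∑ n ∈ Finset.range N, q ^ n := (Finset.prod_univ_sum _ _).symm
    _ ≤ ∏ _i : κ, (1 - q)⁻¹ := by
        refine Finset.prod_le_prod (fun _ _ => Finset.sum_nonneg fun _ _ => pow_nonneg hq0 _)
          fun _ _ => ?_
        rw [← tsum_geometric_of_lt_one hq0 hq]
        exact (summable_geometric_of_lt_one hq0 hq).sum_le_tsum _ fun n _ => pow_nonneg hq0 n

theorem choose_mul_pow_mul_pow_le {x y : ℝ} (hx : 0 ≤ x) (hy : 0 ≤ y) (n k : ℕ) :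
    ((n + k).choose n : ℝ) * x ^ n * y ^ k ≤ (x + y) ^ (n + k) := by
  rw [add_pow]
  refine le_trans (le_of_eq ?_) (Finset.single_le_sum
    (f := fun m => x ^ m * y ^ (n + k - m) * ((n + k).choose m : ℝ))
    (fun m _ => by positivity) (Finset.mem_range.2 (by omega : n < n + k + 1)))
  simp only [Nat.add_sub_cancel_left]
  ring

theorem summable_of_summable_rpow {ι : Type*} {f : ι → ℝ} (hf : ∀ i, 0 ≤ f i) {p : ℝ}
    (hp0 : 0 < p) (hp1 : p ≤ 1) (h : Summable fun i => f i ^ p) : Summable f := by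
  refine h.of_norm_bounded_eventually ?_
  filter_upwards [h.tendsto_cofinite_zero.eventually_lt_const one_pos] with i hi
  rw [Real.norm_of_nonneg (hf i)]
  have hlt : f i < 1 := by
    by_contra! hge
    exact (Real.one_le_rpow hge hp0.le).not_gt hi
  exact Real.self_le_rpow_of_le_one (hf i) hlt.le hp1

namespace multinomialTerm

variable {ι : Type*}

/-- If `x` bounds the sum of `a` over `s`, then splitting the multi-index along `s` trades the
multinomial coefficient for geometric factors with ratio `x + b`. -/
theorem le_pow_mul {a : ι → ℝ} (ha : ∀ j, 0 ≤ a j) {s : Finset ι} {x b : ℝ} (hb : 0 < b)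
    (hx : ∑ j ∈ s, a j ≤ x) {μ κ : ι →₀ ℕ} (hμ : μ.support ⊆ s) (hκ : Disjoint κ.support s) :
    multinomialTerm a (μ + κ) ≤
      (x + b) ^ μ.degree * multinomialTerm (fun j => (x + b) / b * a j) κ := by
  have hx0 : 0 ≤ x := (Finset.sum_nonneg fun j _ => ha j).trans hx
  have hT := nonneg ha κ
  rw [add_of_disjoint a (hκ.symm.mono_left hμ), const_mul]
  calc ((μ.degree + κ.degree).choose μ.degree : ℝ) * multinomialTerm a μ * multinomialTerm a κ
      ≤ ((μ.degree + κ.degree).choose μ.degree : ℝ) * x ^ μ.degree * multinomialTerm a κ := by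
        have h1 : multinomialTerm a μ ≤ x ^ μ.degree := (le_sum_pow ha hμ).trans
          (pow_le_pow_left₀ (Finset.sum_nonneg fun j _ => ha j) hx _)
        gcongr
    _ = ((μ.degree + κ.degree).choose μ.degree : ℝ) * x ^ μ.degree * b ^ κ.degree *
          (multinomialTerm a κ / b ^ κ.degree) := by
        field_simp
    _ ≤ (x + b) ^ (μ.degree + κ.degree) * (multinomialTerm a κ / b ^ κ.degree) := by
        gcongr
        exact choose_mul_pow_mul_pow_le hx0 hb.le _ _
    _ = _ := by
        rw [pow_add, div_pow]
        field_simp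

theorem summable_rpow {p : ℝ} (hp0 : 0 < p) (hp1 : p ≤ 1) {a : ι → ℝ} (ha : ∀ j, 0 ≤ a j)
    (hsum : Summable a) (hlt : ∑' j, a j < 1) (hap : Summable fun j => a j ^ p) :
    Summable fun ν => multinomialTerm a ν ^ p := by
  classical
  obtain ⟨r, hxr, hr1⟩ := exists_between hlt
  have hx0 : 0 ≤ ∑' j, a j := tsum_nonneg ha
  have hr0 : 0 < r := hx0.trans_lt hxr
  obtain ⟨b, hb, hbr⟩ : ∃ b, 0 < b ∧ ∑' j, a j + b = r := ⟨r - ∑' j, a j, by linarith, by ring⟩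
  have hq0 : 0 ≤ r ^ p := by positivity
  have hq1 : r ^ p < 1 := Real.rpow_lt_one hr0.le hr1 hp0
  obtain ⟨s, hs⟩ := summable_iff_vanishing_norm.1 hap (b ^ p) (by positivity)
  let c : ι → ℝ := fun j => if j ∈ s then 0 else r / b * a j
  have hc (j : ι) : 0 ≤ c j := by
    have := ha j
    simp only [c]
    split_ifs <;> positivity
  have hcsum (t : Finset ι) : ∑ j ∈ t, c j ^ p ≤ r ^ p := by
    have h1 : ∑ j ∈ t, c j ^ p = (r / b) ^ p * ∑ j ∈ t \ s, a j ^ p := by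
      rw [Finset.mul_sum, Finset.sdiff_eq_filter, Finset.sum_filter]
      refine Finset.sum_congr rfl fun j _ => ?_
      by_cases hj : j ∈ s
      · simp [c, hj, Real.zero_rpow hp0.ne']
      · simp [c, hj, Real.mul_rpow (div_pos hr0 hb).le (ha j)]
    have h2 := (le_abs_self _).trans (hs (t \ s) Finset.sdiff_disjoint).le
    rw [h1]
    calc (r / b) ^ p * ∑ j ∈ t \ s, a j ^ p ≤ (r / b) ^ p * b ^ p := by gcongr
      _ = r ^ p := by
        rw [← Real.mul_rpow (div_pos hr0 hb).le hb.le, div_mul_cancel₀ _ hb.ne']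
  have hmaj := (summable_pow_sum_of_lt_one (κ := s) hq0 hq1).mul_of_nonneg
    (summable (fun j => Real.rpow_nonneg (hc j) p) hq1 hcsum)
    (fun _ => pow_nonneg hq0 _) (nonneg fun j => Real.rpow_nonneg (hc j) p)
  let e : (ι →₀ ℕ) → (s → ℕ) × (ι →₀ ℕ) := fun ν => (fun i => ν i, ν.filter (· ∉ s))
  have he : Function.Injective e := fun ν ν' h => by
    ext j
    by_cases hj : j ∈ s
    · exact congrFun (congrArg Prod.fst h) ⟨j, hj⟩
    · simpa [e, hj] using DFunLike.congr_fun (congrArg Prod.snd h) j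
  refine (hmaj.comp_injective he).of_nonneg_of_le
    (fun ν => Real.rpow_nonneg (nonneg ha ν) p) fun ν => ?_
  have hμ : (ν.filter (· ∈ s)).support ⊆ s := fun j hj => by
    simp only [Finsupp.support_filter, Finset.mem_filter] at hj
    exact hj.2
  have hκ (j : ι) (hj : j ∈ (ν.filter (· ∉ s)).support) : j ∉ s := by
    simp only [Finsupp.support_filter, Finset.mem_filter] at hj
    exact hj.2
  have hdeg : (ν.filter (· ∈ s)).degree = ∑ i : s, ν i := by
    rw [Finset.sum_coe_sort s fun i => ν i, Finsupp.degree_apply,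
      Finset.sum_subset hμ fun j _ hj => Finsupp.notMem_support_iff.1 hj]
    exact Finset.sum_congr rfl fun j hj => Finsupp.filter_apply_pos _ _ hj
  have hle := le_pow_mul ha hb (hsum.sum_le_tsum s fun j _ => ha j) hμ
    (Finset.disjoint_left.2 hκ)
  rw [hbr, Finsupp.filter_add_filter_not, hdeg,
    congr (b := c) (ν := ν.filter (· ∉ s)) fun j hj => by simp [c, hκ j hj]] at hle
  calc multinomialTerm a ν ^ p
      ≤ (r ^ (∑ i : s, ν i) * multinomialTerm c (ν.filter (· ∉ s))) ^ p :=
        Real.rpow_le_rpow (nonneg ha ν) hle hp0.le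
    _ = (r ^ p) ^ (∑ i : s, ν i) * multinomialTerm c (ν.filter (· ∉ s)) ^ p := by
        rw [Real.mul_rpow (by positivity) (nonneg hc _), Real.rpow_pow_comm hr0.le]
    _ ≤ (r ^ p) ^ (∑ i : s, ν i) * multinomialTerm (fun j => c j ^ p) (ν.filter (· ∉ s)) := by
        gcongr
        exact rpow_le hp1 hc _

theorem summable_rpow_iff {p : ℝ} (hp0 : 0 < p) (hp1 : p ≤ 1) {a : ι → ℝ} (ha : ∀ j, 0 ≤ a j) :
    (Summable fun ν => multinomialTerm a ν ^ p) ↔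
      (Summable a ∧ ∑' j, a j < 1 ∧ Summable fun j => a j ^ p) := by
  refine ⟨fun h => ?_, fun ⟨h1, h2, h3⟩ => summable_rpow hp0 hp1 ha h1 h2 h3⟩
  have hap : Summable fun j => a j ^ p := by
    simpa [Function.comp_def, single] using
      h.comp_injective (Finsupp.single_left_injective (one_ne_zero (α := ℕ)))
  have hsum := summable_of_summable_rpow ha hp0 hp1 hap
  exact ⟨hsum, tsum_lt_one ha (summable_of_summable_rpow (nonneg ha) hp0 hp1 h) hsum, hap⟩

end multinomialTerm

/-- For `0 < p ≤ 1` and a nonnegative sequence `a`, the family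
`(|ν|!/ν!) aᵛ` over finitely supported multi-indices `ν` is `ℓ_p`-summable if and only if
`∑ⱼ aⱼ < 1` (with the series convergent) and `(aⱼ) ∈ ℓ_p`. Here `|ν| = ∑ⱼ νⱼ`,
`ν! = ∏ⱼ νⱼ!` and `aᵛ = ∏ⱼ aⱼ^{νⱼ}`. -/
theorem stmt9 (p : ℝ) (hp0 : 0 < p) (hp1 : p ≤ 1) (a : ℕ → ℝ) (ha : ∀ j, 0 ≤ a j) :
    Summable (fun ν : ℕ →₀ ℕ =>
        (((Nat.factorial (ν.sum fun _ n => n) : ℝ) /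
            (∏ j ∈ ν.support, (Nat.factorial (ν j) : ℝ))) *
          ∏ j ∈ ν.support, a j ^ ν j) ^ p) ↔
      (Summable a ∧ (∑' j, a j) < 1 ∧ Summable fun j => a j ^ p) := by
  exact multinomialTerm.summable_rpow_iff hp0 hp1 ha
end

section
/- Let d ∈ ℕ, let v = (v_1, …, v_d) be weights with v_j > 1 for all j, let t ≥ 1, and set a_j = 2 log₂(v_j) and A = log₂(t). Then the set J_d(t,v) = { ν ∈ ℕ₀^d : 2^{#{j : ν_j ≠ 0}} ∏_{j : ν_j ≠ 0} v_j^{2ν_j} ≤ t } is finite and its cardinality satisfies #J_d(t,v) ≤ 1 + ∑_{k=1}^{min{d, ⌊A⌋}} ((A-k)^k / k!) ∑_{S} ∏_{ℓ ∈ S} a_ℓ^{-1}, where the inner sum runs over subsets S ⊆ {1,…,d} with #S = k and ∑_{j∈S} a_j ≤ A - k. -/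
theorem add_pow_succ_ge {x a : ℝ} (hx : 0 ≤ x) (ha : 0 ≤ a) (k : ℕ) :
    x ^ (k + 1) + (k + 1) * a * x ^ k ≤ (x + a) ^ (k + 1) := by
  induction k with
  | zero => simp
  | succ k ih =>
    have h := mul_le_mul_of_nonneg_right ih (add_nonneg hx ha)
    have h2 : 0 ≤ ((k : ℝ) + 1) * a * a * x ^ k := by positivity
    calc x ^ (k + 1 + 1) + ((k + 1 : ℕ) + 1) * a * x ^ (k + 1)
        ≤ (x ^ (k + 1) + (k + 1) * a * x ^ k) * (x + a) := by
          push_cast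
          linear_combination h2
      _ ≤ (x + a) ^ (k + 1) * (x + a) := h
      _ = (x + a) ^ (k + 1 + 1) := (pow_succ _ _).symm

/-- A lower Riemann sum of the decreasing function `y ↦ (k + 1) * (B - y) ^ k` on `[0, a * M]`
is at most its integral. -/
theorem sum_Icc_sub_mul_pow_le {a B : ℝ} (ha : 0 ≤ a) (k M : ℕ) (hM : a * M ≤ B) :
    ∑ m ∈ Finset.Icc 1 M, (k + 1) * a * (B - a * m) ^ k ≤
      B ^ (k + 1) - (B - a * M) ^ (k + 1) := by
  induction M with
  | zero => simp
  | succ M ih =>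
    push_cast at hM
    rw [Finset.sum_Icc_succ_top (by omega)]
    have h := add_pow_succ_ge (x := B - a * (M + 1)) (by linarith) ha k
    rw [show B - a * (M + 1) + a = B - a * M by ring] at h
    have := ih (by linarith)
    push_cast
    linarith

/-- The lattice points with support exactly `S` in the simplex `∑ j ∈ S, a j * ν j ≤ B` number at
most the volume `B ^ #S / (#S)! * ∏ j ∈ S, (a j)⁻¹` of the simplex. -/
theorem exists_finset_cover_simplex {ι : Type*} {a : ι → ℝ} (ha : ∀ j, 0 < a j)
    (S : Finset ι) (B : ℝ) (hB : 0 ≤ B) :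
    ∃ F : Finset (ι → ℕ),
      (∀ ν : ι → ℕ, (∀ j, ν j ≠ 0 ↔ j ∈ S) → ∑ j ∈ S, a j * ν j ≤ B → ν ∈ F) ∧
      (F.card : ℝ) ≤ B ^ S.card / Nat.factorial S.card * ∏ j ∈ S, (a j)⁻¹ := by
  classical
  induction S using Finset.induction_on generalizing B with
  | empty =>
    refine ⟨{0}, fun ν hν _ => ?_, by simp⟩
    rw [Finset.mem_singleton]
    ext j
    simpa using hν j
  | insert i S hi ih =>
    choose! F hmem hcard using ih
    have hai := ha i
    have hle : ∀ m : ℕ, m ≤ ⌊B / a i⌋₊ → a i * m ≤ B := fun m hm => by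
      have := (Nat.le_floor_iff (div_nonneg hB hai.le)).1 hm
      rwa [le_div_iff₀' hai] at this
    refine ⟨(Finset.Icc 1 ⌊B / a i⌋₊).biUnion fun m =>
      (F (B - a i * m)).image fun ν => Function.update ν i m, fun ν hν hsum => ?_, ?_⟩
    · rw [Finset.sum_insert hi] at hsum
      have hS : 0 ≤ ∑ j ∈ S, a j * (ν j : ℝ) :=
        Finset.sum_nonneg fun j _ => mul_nonneg (ha j).le (Nat.cast_nonneg _)
      have hνi : ν i ≠ 0 := (hν i).2 (Finset.mem_insert_self _ _)
      have hupd : ∀ j ∈ S, Function.update ν i 0 j = ν j := fun j hj =>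
        Function.update_of_ne (ne_of_mem_of_not_mem hj hi) _ _
      simp only [Finset.mem_biUnion, Finset.mem_image, Finset.mem_Icc]
      refine ⟨ν i, ⟨Nat.one_le_iff_ne_zero.2 hνi, Nat.le_floor ?_⟩,
        Function.update ν i 0, hmem _ (by linarith) _ (fun j => ?_) ?_, by simp⟩
      · rw [le_div_iff₀' hai]
        linarith
      · rcases eq_or_ne j i with rfl | hj
        · simp [hi]
        · simpa [hj] using hν j
      · rw [Finset.sum_congr rfl fun j hj => by rw [hupd j hj]]
        linarith
    · set k := S.card with hk
      set P := ∏ j ∈ S, (a j)⁻¹ with hP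
      have hP0 : 0 ≤ P := Finset.prod_nonneg fun j _ => (inv_pos.2 (ha j)).le
      have hfac : (0 : ℝ) < Nat.factorial k := by positivity
      have hM := hle _ le_rfl
      have key := sum_Icc_sub_mul_pow_le hai.le k _ hM
      have hlast : 0 ≤ (B - a i * ⌊B / a i⌋₊) ^ (k + 1) := pow_nonneg (by linarith) _
      rw [Finset.card_insert_of_notMem hi, Finset.prod_insert hi]
      calc ((Finset.card _ : ℕ) : ℝ)
          ≤ ∑ m ∈ Finset.Icc 1 ⌊B / a i⌋₊, ((F (B - a i * m)).card : ℝ) := by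
            exact_mod_cast Finset.card_biUnion_le.trans
              (Finset.sum_le_sum fun m _ => Finset.card_image_le)
        _ ≤ ∑ m ∈ Finset.Icc 1 ⌊B / a i⌋₊,
              (B - a i * m) ^ k / Nat.factorial k * P :=
            Finset.sum_le_sum fun m hm =>
              hcard _ (sub_nonneg.2 (hle m (Finset.mem_Icc.1 hm).2))
        _ = (∑ m ∈ Finset.Icc 1 ⌊B / a i⌋₊, (k + 1) * a i * (B - a i * m) ^ k) *
              (P * (a i)⁻¹ / ((k + 1) * Nat.factorial k)) := by
            rw [Finset.sum_mul]
            refine Finset.sum_congr rfl fun m _ => ?_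
            field_simp
        _ ≤ B ^ (k + 1) * (P * (a i)⁻¹ / ((k + 1) * Nat.factorial k)) :=
            mul_le_mul_of_nonneg_right (by linarith) (by positivity)
        _ = B ^ (k + 1) / Nat.factorial (k + 1) * ((a i)⁻¹ * P) := by
            rw [Nat.factorial_succ]
            push_cast
            field_simp

/-- cardinality bound for the index set
`J_d(t,v) = {ν ∈ ℕ₀^d : 2^{‖ν‖₀} ∏_{j ∈ supp ν} vⱼ^{2νⱼ} ≤ t}`: with `aⱼ = 2 log₂ vⱼ` and
`A = log₂ t`, the set is finite and
`#J_d(t,v) ≤ 1 + ∑_{k=1}^{min(d,⌊A⌋)} ((A-k)^k/k!) ∑_{S ⊆ [d], #S = k, ∑_{j∈S} aⱼ ≤ A-k} ∏_{ℓ∈S} aℓ⁻¹`. -/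
theorem stmt12 (d : ℕ) (v : Fin d → ℝ) (hv : ∀ j, 1 < v j) (t : ℝ) (ht : 1 ≤ t)
    (J : Set (Fin d → ℕ))
    (hJ : J = {ν : Fin d → ℕ |
      (2 : ℝ) ^ (Finset.univ.filter (fun j => ν j ≠ 0)).card *
        ∏ j ∈ Finset.univ.filter (fun j => ν j ≠ 0), v j ^ (2 * ν j) ≤ t}) :
    J.Finite ∧
    (J.ncard : ℝ) ≤ 1 +
      ∑ k ∈ Finset.Icc 1 (min d ⌊Real.logb 2 t⌋₊),
        (Real.logb 2 t - k) ^ k / Nat.factorial k *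
          ∑ S ∈ (Finset.powersetCard k (Finset.univ : Finset (Fin d))).filter
              (fun S => (∑ j ∈ S, 2 * Real.logb 2 (v j)) ≤ Real.logb 2 t - k),
            ∏ ℓ ∈ S, (2 * Real.logb 2 (v ℓ))⁻¹ := by
  set a : Fin d → ℝ := fun j => 2 * Real.logb 2 (v j) with ha_def
  set A := Real.logb 2 t with hA
  have ha : ∀ j, 0 < a j := fun j => mul_pos two_pos (Real.logb_pos one_lt_two (hv j))
  have hA0 : 0 ≤ A := Real.logb_nonneg one_lt_two ht
  choose! F hmem hcard using exists_finset_cover_simplex ha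
  let I : ℕ → Finset (Finset (Fin d)) := fun k =>
    (Finset.powersetCard k (Finset.univ : Finset (Fin d))).filter
      (fun S => ∑ j ∈ S, a j ≤ A - k)
  let G : Finset (Fin d → ℕ) :=
    {0} ∪ (Finset.Icc 1 (min d ⌊A⌋₊)).biUnion fun k => (I k).biUnion fun S => F S (A - k)
  have hJG : J ⊆ G := by
    intro ν hν
    rw [hJ, Set.mem_ofPred_eq] at hν
    set S := Finset.univ.filter (fun j => ν j ≠ 0) with hS
    have hv0 : ∀ j, 0 < v j := fun j => one_pos.trans (hv j)
    have hlog : (S.card : ℝ) + ∑ j ∈ S, a j * ν j ≤ A := by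
      have hprod : 0 < ∏ j ∈ S, v j ^ (2 * ν j) :=
        Finset.prod_pos fun j _ => pow_pos (hv0 j) _
      have h := Real.logb_le_logb_of_le one_lt_two (by positivity) hν
      rw [Real.logb_mul (by positivity) hprod.ne', Real.logb_pow,
        Real.logb_self_eq_one one_lt_two, mul_one,
        Real.logb_prod (hf := fun j _ => (pow_pos (hv0 j) _).ne')] at h
      refine le_trans (le_of_eq ?_) h
      congr 1
      refine Finset.sum_congr rfl fun j _ => ?_
      rw [Real.logb_pow, ha_def]
      push_cast
      ring
    have hsupp : ∀ j, ν j ≠ 0 ↔ j ∈ S := fun j => by simp [hS]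
    have hone : ∑ j ∈ S, a j ≤ ∑ j ∈ S, a j * ν j := Finset.sum_le_sum fun j hj =>
      le_mul_of_one_le_right (ha j).le
        (by exact_mod_cast Nat.one_le_iff_ne_zero.2 ((hsupp j).2 hj))
    have hpos : 0 ≤ ∑ j ∈ S, a j := Finset.sum_nonneg fun j _ => (ha j).le
    simp only [G, I, Finset.coe_union, Set.mem_union, Finset.mem_coe, Finset.mem_singleton,
      Finset.mem_biUnion, Finset.mem_Icc, Finset.mem_filter, Finset.mem_powersetCard,
      Finset.subset_univ, true_and]
    rcases S.eq_empty_or_nonempty with h0 | h0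
    · left
      ext j
      simpa [h0] using hsupp j
    · exact Or.inr ⟨S.card, ⟨h0.card_pos, le_min (by simpa using S.card_le_univ)
        (Nat.le_floor (by linarith))⟩, S, ⟨rfl, by linarith⟩,
        hmem S _ (by linarith) ν hsupp (by linarith)⟩
  refine ⟨G.finite_toSet.subset hJG, ?_⟩
  have hGcard : G.card ≤ 1 + ∑ k ∈ Finset.Icc 1 (min d ⌊A⌋₊), ∑ S ∈ I k, (F S (A - k)).card :=
    (Finset.card_union_le _ _).trans (Nat.add_le_add (Finset.card_singleton _).le
      (Finset.card_biUnion_le.trans (Finset.sum_le_sum fun k _ => Finset.card_biUnion_le)))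
  have hJcard : J.ncard ≤ G.card := by
    simpa using Set.ncard_le_ncard hJG G.finite_toSet
  calc (J.ncard : ℝ)
      ≤ 1 + ∑ k ∈ Finset.Icc 1 (min d ⌊A⌋₊), ∑ S ∈ I k, ((F S (A - k)).card : ℝ) := by
        exact_mod_cast hJcard.trans hGcard
    _ ≤ _ := by
        gcongr with k hk
        rw [Finset.mul_sum]
        refine Finset.sum_le_sum fun S hS => ?_
        have hkA : (k : ℝ) ≤ A :=
          (Nat.le_floor_iff hA0).1 ((Finset.mem_Icc.1 hk).2.trans (min_le_right _ _))
        have hSk : S.card = k := (Finset.mem_powersetCard.1 (Finset.mem_filter.1 hS).1).2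
        simpa only [hSk] using hcard S (A - k) (by linarith)
end

section
/- Let k ∈ ℕ with k ≥ 1, let b = (b_1, …, b_k) be positive real numbers, and let L > 0. Then the set { ν ∈ ℕ^k : ν_j ≥ 1 for all j and ∑_{j=1}^k b_j ν_j ≤ L } is finite and its cardinality is at most L^k / (k! ∏_{j=1}^k b_j). -/
theorem add_one_mul_mul_pow_le_sub {x b : ℝ} (hx : 0 ≤ x) (hb : 0 ≤ b) (k : ℕ) :
    (k + 1) * b * x ^ k ≤ (x + b) ^ (k + 1) - x ^ (k + 1) := by
  induction k with
  | zero => simp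
  | succ k ih =>
    have hpow : x ^ (k + 1) ≤ (x + b) ^ (k + 1) := by gcongr; linarith
    have h₁ := mul_le_mul_of_nonneg_left ih hx
    have h₂ := mul_le_mul_of_nonneg_left hpow hb
    push_cast
    linear_combination h₁ + h₂

theorem sum_mul_sub_pow_le {L b : ℝ} (hb : 0 ≤ b) (k N : ℕ) (hN : b * N ≤ L) :
    ∑ m ∈ Finset.range N, (k + 1) * b * (L - b * (m + 1 : ℕ)) ^ k ≤
      L ^ (k + 1) - (L - b * N) ^ (k + 1) := by
  induction N with
  | zero => simp
  | succ N ih =>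
    rw [Finset.sum_range_succ]
    have hle : b * N ≤ L := by push_cast at hN; linarith
    have h := add_one_mul_mul_pow_le_sub (sub_nonneg.2 hN) hb k
    have hx : L - b * (N + 1 : ℕ) + b = L - b * N := by push_cast; ring
    rw [hx] at h
    linarith [ih hle]

/-- The positive lattice points of a simplex are covered by a finite set whose cardinality
is at most the volume of the simplex. -/
theorem exists_finset_cover_simplex_s13 (k : ℕ) (b : Fin k → ℝ) (hb : ∀ j, 0 < b j)
    (L : ℝ) (hL : 0 ≤ L) :
    ∃ F : Finset (Fin k → ℕ),
      (∀ ν : Fin k → ℕ, (∀ j, 1 ≤ ν j) → ∑ j, b j * ν j ≤ L → ν ∈ F) ∧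
      (F.card : ℝ) ≤ L ^ k / (Nat.factorial k * ∏ j, b j) := by
  induction k generalizing L with
  | zero => exact ⟨Finset.univ, fun _ _ _ => Finset.mem_univ _, by simp⟩
  | succ k ih =>
    have hb₀ := hb 0
    choose! F hF hcard using ih (fun j => b j.succ) (fun j => hb _)
    set N := ⌊L / b 0⌋₊
    have hN : b 0 * N ≤ L := by
      have h := Nat.floor_le (div_nonneg hL hb₀.le)
      rw [le_div_iff₀ hb₀] at h
      linarith
    refine ⟨(Finset.range N).biUnion fun m =>
      (F (L - b 0 * (m + 1 : ℕ))).image (Fin.cons (α := fun _ => ℕ) (m + 1)), ?_, ?_⟩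
    · intro ν hν hsum
      rw [Fin.sum_univ_succ] at hsum
      have htail : 0 ≤ ∑ j : Fin k, b j.succ * (ν j.succ : ℝ) :=
        Finset.sum_nonneg fun j _ => mul_nonneg (hb _).le (Nat.cast_nonneg _)
      have hle : ν 0 ≤ N := by
        apply Nat.le_floor
        rw [le_div_iff₀ hb₀]
        linarith
      have hν₀ : ν 0 - 1 + 1 = ν 0 := Nat.sub_add_cancel (hν 0)
      rw [Finset.mem_biUnion]
      refine ⟨ν 0 - 1, Finset.mem_range.2 (by omega), ?_⟩
      rw [hν₀]
      refine Finset.mem_image.2 ⟨Fin.tail ν, hF _ (by linarith) _ (fun j => hν _) ?_,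
        Fin.cons_self_tail ν⟩
      simp only [Fin.tail]
      linarith
    · have hP : 0 < ∏ j : Fin k, b j.succ := Finset.prod_pos fun j _ => hb _
      have hk : (0 : ℝ) < Nat.factorial k := by exact_mod_cast Nat.factorial_pos k
      have hcover : ∀ m ∈ Finset.range N,
          (((F (L - b 0 * (m + 1 : ℕ))).image
            (Fin.cons (α := fun _ => ℕ) (m + 1))).card : ℝ) ≤
          (L - b 0 * (m + 1 : ℕ)) ^ k / (Nat.factorial k * ∏ j : Fin k, b j.succ) := by
        intro m hm
        refine le_trans (Nat.cast_le.2 Finset.card_image_le) (hcard _ ?_)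
        have hmN : ((m + 1 : ℕ) : ℝ) ≤ N := Nat.cast_le.2 (Finset.mem_range.1 hm)
        linarith [mul_le_mul_of_nonneg_left hmN hb₀.le]
      have htele := sum_mul_sub_pow_le hb₀.le k N hN
      have hrest : 0 ≤ (L - b 0 * N) ^ (k + 1) := pow_nonneg (sub_nonneg.2 hN) _
      rw [← Finset.mul_sum] at htele
      refine le_trans (Nat.cast_le.2 Finset.card_biUnion_le) ?_
      rw [Nat.cast_sum]
      refine le_trans (Finset.sum_le_sum hcover) ?_
      rw [← Finset.sum_div, Fin.prod_univ_succ, Nat.factorial_succ,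
        div_le_div_iff₀ (by positivity) (by positivity)]
      push_cast at htele ⊢
      have h := mul_le_mul_of_nonneg_right (htele.trans (sub_le_self _ hrest))
        (mul_pos hk hP).le
      linarith

/-- The set `{ν ∈ ℕ^k : νⱼ ≥ 1, ∑ⱼ bⱼ νⱼ ≤ L}` is finite with cardinality at
most `L^k / (k! ∏ⱼ bⱼ)`, for positive `bⱼ` and `L > 0`. -/
theorem stmt13 (k : ℕ) (hk : 1 ≤ k) (b : Fin k → ℝ) (hb : ∀ j, 0 < b j)
    (L : ℝ) (hL : 0 < L) :
    {ν : Fin k → ℕ | (∀ j, 1 ≤ ν j) ∧ (∑ j, b j * ν j) ≤ L}.Finite ∧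
    ({ν : Fin k → ℕ | (∀ j, 1 ≤ ν j) ∧ (∑ j, b j * ν j) ≤ L}.ncard : ℝ) ≤
      L ^ k / (Nat.factorial k * ∏ j, b j) := by
  obtain ⟨F, hF, hcard⟩ := exists_finset_cover_simplex_s13 k b hb L hL.le
  have hsub : {ν : Fin k → ℕ | (∀ j, 1 ≤ ν j) ∧ (∑ j, b j * ν j) ≤ L} ⊆ (F : Set _) :=
    fun ν hν => hF ν hν.1 hν.2
  refine ⟨F.finite_toSet.subset hsub, le_trans (Nat.cast_le.2 ?_) hcard⟩
  simpa using Set.ncard_le_ncard hsub F.finite_toSet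
end

section
/- Let β > 1, d ≥ 1 an integer, s ≥ 1, and let J = { ν ∈ ℕ₀^d : 2^{#{j : ν_j ≠ 0}} · β^{2∑_{j=1}^d ν_j} ≤ s/2 }. If d ≤ log_{2β²}(s/2), then #J ≤ (log_{β²}(β² s/2))^d; otherwise #J ≤ ((1 + 1/log₂(β²)) · e · d)^{log_{2β²}(s/2)}. -/
theorem le_logb_of_pow_le {b x : ℝ} (hb : 1 < b) {n : ℕ} (h : b ^ n ≤ x) :
    (n : ℝ) ≤ Real.logb b x := by
  have hpos : 0 < b ^ n := pow_pos (by linarith) n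
  rw [Real.le_logb_iff_rpow_le hb (hpos.trans_le h), Real.rpow_natCast]
  exact h

section

variable {ι : Type*} [Fintype ι] {a S : ℝ} {ν : ι → ℕ}

theorem one_le_of_two_pow_mul_pow_le (ha : 1 < a)
    (h : (2 : ℝ) ^ (Finset.univ.filter (fun j => ν j ≠ 0)).card * a ^ (∑ j, ν j) ≤ S) :
    1 ≤ S :=
  (one_le_mul_of_one_le_of_one_le (one_le_pow₀ one_le_two) (one_le_pow₀ ha.le)).trans h

theorem apply_le_floor_logb (ha : 1 < a)
    (h : (2 : ℝ) ^ (Finset.univ.filter (fun j => ν j ≠ 0)).card * a ^ (∑ j, ν j) ≤ S) (j : ι) :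
    ν j ≤ ⌊Real.logb a S⌋₊ := by
  refine Nat.le_floor (le_logb_of_pow_le ha (le_trans ?_ h))
  calc a ^ ν j ≤ a ^ (∑ j, ν j) :=
        pow_le_pow_right₀ ha.le (Finset.single_le_sum (fun _ _ => Nat.zero_le _)
          (Finset.mem_univ j))
    _ ≤ _ := le_mul_of_one_le_left (by positivity) (one_le_pow₀ one_le_two)

theorem card_support_le_logb (ha : 1 < a)
    (h : (2 : ℝ) ^ (Finset.univ.filter (fun j => ν j ≠ 0)).card * a ^ (∑ j, ν j) ≤ S) :
    ((Finset.univ.filter (fun j => ν j ≠ 0)).card : ℝ) ≤ Real.logb (2 * a) S := by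
  refine le_logb_of_pow_le (by linarith) (le_trans ?_ h)
  rw [mul_pow]
  gcongr
  · exact ha.le
  · calc (Finset.univ.filter (fun j => ν j ≠ 0)).card
        = ∑ j ∈ Finset.univ.filter (fun j => ν j ≠ 0), 1 := by simp
      _ ≤ ∑ j ∈ Finset.univ.filter (fun j => ν j ≠ 0), ν j :=
          Finset.sum_le_sum fun j hj => Nat.one_le_iff_ne_zero.2 (Finset.mem_filter.1 hj).2
      _ ≤ ∑ j, ν j := Finset.sum_le_sum_of_subset (Finset.filter_subset _ _)

end

/-- The functions supported on a set of at most `K` coordinates and bounded by `N`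
are counted according to their support. -/
theorem ncard_le_sum_pow_card {ι : Type*} [Fintype ι] [DecidableEq ι] (J : Set (ι → ℕ)) (N : ℕ)
    (K : ℝ) (hN : ∀ ν ∈ J, ∀ j, ν j ≤ N)
    (hK : ∀ ν ∈ J, ((Finset.univ.filter (fun j => ν j ≠ 0)).card : ℝ) ≤ K) :
    J.ncard ≤ ∑ P : Finset ι with (P.card : ℝ) ≤ K, N ^ P.card := by
  classical
  let F : Finset ι → Finset (ι → ℕ) := fun P =>
    Fintype.piFinset fun j => if j ∈ P then Finset.Icc 1 N else {0}
  have hF (P : Finset ι) : (F P).card = N ^ P.card := by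
    simp [F, apply_ite Finset.card]
  have hsub : J ⊆ ((Finset.univ.filter fun P : Finset ι => (P.card : ℝ) ≤ K).biUnion F :
      Finset (ι → ℕ)) := by
    intro ν hν
    simp only [Finset.coe_biUnion, Set.mem_iUnion, Finset.mem_coe]
    refine ⟨Finset.univ.filter (fun j => ν j ≠ 0), by simpa using hK ν hν, ?_⟩
    rw [Fintype.mem_piFinset]
    intro j
    by_cases hj : ν j = 0
    · simp [hj]
    · simpa [hj, Nat.one_le_iff_ne_zero] using hN ν hν j
  calc J.ncard ≤ ((Finset.univ.filter fun P : Finset ι => (P.card : ℝ) ≤ K).biUnion F).card := by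
        rw [← Set.ncard_coe_finset]
        exact Set.ncard_le_ncard hsub (Finset.finite_toSet _)
    _ ≤ _ := Finset.card_biUnion_le
    _ = _ := Finset.sum_congr rfl fun P _ => hF P

theorem sum_pow_card_le_rpow {d : ℕ} (hd : 1 ≤ d) {K L : ℝ} (hK : 0 ≤ K) (hL : 1 ≤ L) :
    ∑ P : Finset (Fin d) with (P.card : ℝ) ≤ K, (L * K) ^ P.card ≤
      (L * Real.exp 1 * d) ^ K := by
  have hd' : (1 : ℝ) ≤ d := by exact_mod_cast hd
  have hLd : 1 ≤ L * d := one_le_mul_of_one_le_of_one_le hL hd'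
  calc ∑ P : Finset (Fin d) with (P.card : ℝ) ≤ K, (L * K) ^ P.card
      ≤ ∑ P : Finset (Fin d) with (P.card : ℝ) ≤ K, (L * d) ^ K * (K / d) ^ P.card := by
        refine Finset.sum_le_sum fun P hP => ?_
        have hPK : (P.card : ℝ) ≤ K := (Finset.mem_filter.1 hP).2
        rw [show L * K = L * d * (K / d) by field_simp, mul_pow]
        gcongr
        rw [← Real.rpow_natCast]
        exact Real.rpow_le_rpow_of_exponent_le hLd hPK
    _ ≤ ∑ P : Finset (Fin d), (L * d) ^ K * (K / d) ^ P.card :=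
        Finset.sum_le_sum_of_subset_of_nonneg (Finset.filter_subset _ _)
          fun _ _ _ => by positivity
    _ = (L * d) ^ K * (K / d + 1) ^ d := by
        rw [← Finset.mul_sum]
        congr 1
        simpa using Fin.sum_pow_mul_eq_add_pow (K / d) (1 : ℝ)
    _ ≤ (L * d) ^ K * Real.exp K := by
        gcongr
        calc (K / d + 1) ^ d ≤ Real.exp (K / d) ^ d := by
              gcongr
              exact Real.add_one_le_exp _
          _ = Real.exp K := by
              rw [← Real.exp_nat_mul]
              congr 1
              field_simp
    _ = (L * Real.exp 1 * d) ^ K := by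
        rw [mul_right_comm, Real.mul_rpow (x := L * d) (by positivity) (by positivity),
          Real.exp_one_rpow]

theorem one_add_one_div_logb_mul_logb {a : ℝ} (ha : 1 < a) (S : ℝ) :
    (1 + 1 / Real.logb 2 a) * Real.logb (2 * a) S = Real.logb a S := by
  have h2 : 0 < Real.log 2 := Real.log_pos one_lt_two
  have hl : 0 < Real.log a := Real.log_pos ha
  have hne : Real.log 2 + Real.log a ≠ 0 := by positivity
  simp only [Real.logb]
  rw [Real.log_mul two_ne_zero (by linarith)]
  field_simp
  ring

/-- cardinality bound for constant weights `vⱼ = β`, `1 ≤ j ≤ d`. For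
`J = {ν ∈ ℕ₀^d : 2^{‖ν‖₀} β^{2∑ⱼνⱼ} ≤ s/2}`: if `d ≤ log_{2β²}(s/2)` then
`#J ≤ (log_{β²}(β² s/2))^d`, otherwise `#J ≤ ((1 + 1/log₂(β²)) e d)^{log_{2β²}(s/2)}`. -/
theorem stmt14 (β : ℝ) (hβ : 1 < β) (d : ℕ) (hd : 1 ≤ d) (s : ℝ) (hs : 1 ≤ s)
    (J : Set (Fin d → ℕ))
    (hJ : J = {ν : Fin d → ℕ |
      (2 : ℝ) ^ (Finset.univ.filter (fun j => ν j ≠ 0)).card *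
        β ^ (2 * ∑ j, ν j) ≤ s / 2}) :
    J.Finite ∧
    ((d : ℝ) ≤ Real.logb (2 * β ^ 2) (s / 2) →
      (J.ncard : ℝ) ≤ (Real.logb (β ^ 2) (β ^ 2 * s / 2)) ^ d) ∧
    (¬ (d : ℝ) ≤ Real.logb (2 * β ^ 2) (s / 2) →
      (J.ncard : ℝ) ≤
        ((1 + 1 / Real.logb 2 (β ^ 2)) * Real.exp 1 * d) ^
          (Real.logb (2 * β ^ 2) (s / 2))) := by
  subst hJ
  have ha : 1 < β ^ 2 := one_lt_pow₀ hβ two_ne_zero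
  simp only [pow_mul]
  set a := β ^ 2
  set J : Set (Fin d → ℕ) := {ν | (2 : ℝ) ^ (Finset.univ.filter (fun j => ν j ≠ 0)).card *
    a ^ (∑ j, ν j) ≤ s / 2}
  set N := ⌊Real.logb a (s / 2)⌋₊
  have hN (ν) (hν : ν ∈ J) (j) : ν j ≤ N := apply_le_floor_logb ha hν j
  have hsub : J ⊆ (Fintype.piFinset fun _ => Finset.range (N + 1) : Finset (Fin d → ℕ)) := by
    intro ν hν
    simpa [Nat.lt_succ_iff] using hN ν hν
  refine ⟨(Finset.finite_toSet _).subset hsub, fun hdK => ?_, fun _ => ?_⟩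
  · have hK : 0 < Real.logb (2 * a) (s / 2) := lt_of_lt_of_le (by exact_mod_cast hd) hdK
    have hS : 1 < s / 2 := (Real.logb_pos_iff (by linarith) (by linarith)).1 hK
    have hcard : J.ncard ≤ (N + 1) ^ d := by
      have h := Set.ncard_le_ncard hsub (Finset.finite_toSet _)
      rwa [Set.ncard_coe_finset, Fintype.card_piFinset_const, Finset.card_range] at h
    have hlog : Real.logb a (a * s / 2) = Real.logb a (s / 2) + 1 := by
      rw [mul_div_assoc, Real.logb_mul (by linarith) (by linarith), Real.logb_self_eq_one ha,
        add_comm]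
    rw [hlog]
    calc (J.ncard : ℝ) ≤ (N + 1 : ℝ) ^ d := by exact_mod_cast hcard
      _ ≤ _ := by
        gcongr
        exact Nat.floor_le (Real.logb_nonneg ha hS.le)
  · have hL : 1 ≤ 1 + 1 / Real.logb 2 a :=
      le_add_of_nonneg_right (one_div_nonneg.2 (Real.logb_nonneg one_lt_two ha.le))
    rcases J.eq_empty_or_nonempty with hemp | ⟨ν, hν⟩
    · rw [hemp, Set.ncard_empty, Nat.cast_zero]
      positivity
    have hS : 1 ≤ s / 2 := one_le_of_two_pow_mul_pow_le ha hν
    refine le_trans ?_ (sum_pow_card_le_rpow hd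
      (Real.logb_nonneg (b := 2 * a) (by linarith) hS) hL)
    rw [one_add_one_div_logb_mul_logb ha]
    refine (Nat.cast_le.2 (ncard_le_sum_pow_card J N _ hN
      fun ν hν => card_support_le_logb ha hν)).trans ?_
    push_cast
    gcongr
    exact Nat.floor_le (Real.logb_nonneg ha hS)
end

section
/- Let c > 1 and α > 0, and define weights v_j = c j^α for j ≥ 1. For s ≥ 1 let J₀^s = { ν ∈ F : 2^{‖ν‖₀} ∏_{j ∈ supp ν} v_j^{2ν_j} ≤ s/2 }. Then there exist constants C > 0 and γ > 0, depending only on α and c, such that #J₀^s ≤ C · s^{γ log(s)} for all s ≥ 1. -/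
/-- Finitely supported `ν : ℕ →₀ ℕ` of degree at most `k` with support in `range M` number at most
`(M + 1) ^ k`. -/
lemma exists_finset_card_le_of_degree_le (M k : ℕ) :
    ∃ S : Finset (ℕ →₀ ℕ), S.card ≤ (M + 1) ^ k ∧
      ∀ ν : ℕ →₀ ℕ, ν.support ⊆ Finset.range M → ∑ j ∈ ν.support, ν j ≤ k → ν ∈ S := by
  classical
  induction k with
  | zero =>
    refine ⟨{0}, by simp, fun ν _ h ↦ ?_⟩
    rw [Finset.mem_singleton]
    ext j
    by_contra hj
    have hmem : j ∈ ν.support := Finsupp.mem_support_iff.mpr hj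
    have := Finset.single_le_sum (f := fun j ↦ ν j) (fun _ _ ↦ Nat.zero_le _) hmem
    simp only [Finsupp.coe_zero, Pi.zero_apply] at hj
    omega
  | succ k ih =>
    obtain ⟨S, hcard, hS⟩ := ih
    refine ⟨S ∪ (S ×ˢ Finset.range M).image fun p ↦ p.1 + Finsupp.single p.2 1, ?_, ?_⟩
    · calc _ ≤ S.card + (S ×ˢ Finset.range M).card :=
            (Finset.card_union_le _ _).trans (Nat.add_le_add_left Finset.card_image_le _)
        _ = S.card * (M + 1) := by rw [Finset.card_product, Finset.card_range]; ring
        _ ≤ (M + 1) ^ (k + 1) := by rw [pow_succ]; gcongr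
    · intro ν hν hdeg
      rw [Finset.mem_union]
      rcases ν.support.eq_empty_or_nonempty with h0 | ⟨j, hj⟩
      · exact Or.inl (hS ν hν (by simp [h0]))
      right
      have hle : Finsupp.single j 1 ≤ ν := by
        rw [Finsupp.single_le_iff]
        exact Nat.one_le_iff_ne_zero.mpr (Finsupp.mem_support_iff.mp hj)
      have hadd : ν - Finsupp.single j 1 + Finsupp.single j 1 = ν := tsub_add_cancel_of_le hle
      have hsum : (ν - Finsupp.single j 1).degree + 1 = ν.degree := by
        conv_rhs => rw [← hadd, map_add, Finsupp.degree_single]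
      refine Finset.mem_image.mpr ⟨(ν - Finsupp.single j 1, j), ?_, hadd⟩
      refine Finset.mem_product.mpr ⟨hS _ ?_ ?_, hν hj⟩
      · exact (Finsupp.support_mono tsub_le_self).trans hν
      · change (ν - Finsupp.single j 1).degree ≤ k
        change ν.degree ≤ k + 1 at hdeg
        omega

/-- A product of powers of weights `c (j + 1) ^ α` bounded by `s` bounds degree and support. -/
lemma degree_le_and_support_subset_of_prod_le {c α s : ℝ} (hc : 1 < c) (hα : 0 < α)
    {ν : ℕ →₀ ℕ}
    (h : ∏ j ∈ ν.support, (c * ((j : ℝ) + 1) ^ α) ^ (2 * ν j) ≤ s) :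
    ∑ j ∈ ν.support, ν j ≤ ⌊1 / (2 * Real.log c) * Real.log s⌋₊ ∧
      ν.support ⊆ Finset.range ⌊s ^ (1 / α)⌋₊ := by
  have hpow : ∀ j : ℕ, 1 ≤ ((j : ℝ) + 1) ^ α := fun j ↦
    Real.one_le_rpow (by linarith [j.cast_nonneg (α := ℝ)]) hα.le
  have hlog : 0 < Real.log c := Real.log_pos hc
  have hweight : ∀ j : ℕ, c ≤ c * ((j : ℝ) + 1) ^ α := fun j ↦
    le_mul_of_one_le_right (by linarith) (hpow j)
  have hweight1 : ∀ j : ℕ, 1 ≤ c * ((j : ℝ) + 1) ^ α := fun j ↦ hc.le.trans (hweight j)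
  constructor
  · have hs : c ^ (2 * ∑ j ∈ ν.support, ν j) ≤ s := by
      rw [Finset.mul_sum, ← Finset.prod_pow_eq_pow_sum]
      refine (Finset.prod_le_prod (fun j _ ↦ by positivity) fun j _ ↦ ?_).trans h
      exact pow_le_pow_left₀ (by linarith) (hweight j) _
    have := Real.log_le_log (by positivity) hs
    rw [Real.log_pow] at this
    apply Nat.le_floor
    rw [div_mul_eq_mul_div, one_mul, le_div_iff₀ (by positivity)]
    push_cast at this ⊢
    linarith
  · intro j hj
    have hle : ((j : ℝ) + 1) ^ α ≤ s := by
      have hj2 : 2 * ν j ≠ 0 := by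
        have := Finsupp.mem_support_iff.mp hj
        omega
      have hfac : (c * ((j : ℝ) + 1) ^ α) ^ (2 * ν j) ≤ s := by
        refine le_trans ?_ h
        rw [← Finset.mul_prod_erase _ _ hj]
        exact le_mul_of_one_le_right (pow_nonneg (by linarith [hweight1 j]) _)
          (Finset.prod_induction _ (1 ≤ ·) (fun _ _ ↦ one_le_mul_of_one_le_of_one_le) le_rfl
            fun i _ ↦ one_le_pow₀ (hweight1 i))
      calc _ ≤ c * ((j : ℝ) + 1) ^ α := le_mul_of_one_le_left (by positivity) hc.le
        _ ≤ _ := le_self_pow₀ (hweight1 j) hj2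
        _ ≤ s := hfac
    rw [Finset.mem_range, ← Nat.succ_le_iff]
    apply Nat.le_floor
    have := Real.rpow_le_rpow (by positivity) hle (one_div_pos.mpr hα).le
    rwa [← Real.rpow_mul (by positivity), mul_one_div_cancel hα.ne', Real.rpow_one,
      ← Nat.cast_succ] at this

/-- A power of the form `(s ^ a + 1) ^ (b log s)` grows at most like `s ^ (γ log s)`. -/
lemma floor_rpow_add_one_pow_floor_le {a b s : ℝ} (ha : 0 ≤ a) (hb : 0 ≤ b) (hs : 1 ≤ s) :
    (((⌊s ^ a⌋₊ + 1) ^ ⌊b * Real.log s⌋₊ : ℕ) : ℝ) ≤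
      Real.exp b * s ^ ((b + a * b) * Real.log s) := by
  have hs0 : 0 < s := by linarith
  have hL : 0 ≤ Real.log s := Real.log_nonneg hs
  have hbase : ((⌊s ^ a⌋₊ : ℝ) + 1) ≤ Real.exp (1 + a * Real.log s) := by
    have h1 : (⌊s ^ a⌋₊ : ℝ) ≤ s ^ a := Nat.floor_le (by positivity)
    have h2 : 1 ≤ s ^ a := Real.one_le_rpow hs ha
    have h3 : (2 : ℝ) ≤ Real.exp 1 := by linarith [Real.add_one_le_exp (1 : ℝ)]
    rw [Real.exp_add, mul_comm a, ← Real.rpow_def_of_pos hs0]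
    nlinarith
  have hexp : (⌊b * Real.log s⌋₊ : ℝ) ≤ b * Real.log s := Nat.floor_le (by positivity)
  push_cast
  calc _ ≤ Real.exp (1 + a * Real.log s) ^ ⌊b * Real.log s⌋₊ := by gcongr
    _ = Real.exp (⌊b * Real.log s⌋₊ * (1 + a * Real.log s)) := (Real.exp_nat_mul _ _).symm
    _ ≤ Real.exp (b + Real.log s * ((b + a * b) * Real.log s)) := by
      apply Real.exp_le_exp.mpr
      calc _ ≤ b * Real.log s * (1 + a * Real.log s) := by gcongr
        _ ≤ _ := by nlinarith [mul_nonneg hb (sq_nonneg (Real.log s - 1)), mul_nonneg hb hL]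
    _ = _ := by rw [Real.exp_add, ← Real.rpow_def_of_pos hs0]


/-- cardinality of the index set for polynomially growing weights
`vⱼ = c jᵅ` (`j ≥ 1`; in 0-based indexing `v` at index `j` is `c (j+1)ᵅ`). For
`J₀ˢ = {ν ∈ F : 2^{‖ν‖₀} ∏_{j ∈ supp ν} vⱼ^{2νⱼ} ≤ s/2}` there are constants `C, γ > 0`
depending only on `α` and `c` with `#J₀ˢ ≤ C s^{γ log s}` for all `s ≥ 1`. -/
theorem stmt15 (c α : ℝ) (hc : 1 < c) (hα : 0 < α) :
    ∃ C γ : ℝ, 0 < C ∧ 0 < γ ∧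
      ∀ s : ℝ, 1 ≤ s →
        ∀ J : Set (ℕ →₀ ℕ),
          J = {ν : ℕ →₀ ℕ |
            (2 : ℝ) ^ ν.support.card *
              ∏ j ∈ ν.support, (c * ((j : ℝ) + 1) ^ α) ^ (2 * ν j) ≤ s / 2} →
          J.Finite ∧ (J.ncard : ℝ) ≤ C * s ^ (γ * Real.log s) := by
  have hlog : 0 < Real.log c := Real.log_pos hc
  refine ⟨Real.exp (1 / (2 * Real.log c)),
    1 / (2 * Real.log c) + 1 / α * (1 / (2 * Real.log c)), Real.exp_pos _, by positivity, ?_⟩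
  rintro s hs J rfl
  obtain ⟨S, hcard, hS⟩ := exists_finset_card_le_of_degree_le ⌊s ^ (1 / α)⌋₊
    ⌊1 / (2 * Real.log c) * Real.log s⌋₊
  have hsub : {ν : ℕ →₀ ℕ | (2 : ℝ) ^ ν.support.card *
      ∏ j ∈ ν.support, (c * ((j : ℝ) + 1) ^ α) ^ (2 * ν j) ≤ s / 2} ⊆ (S : Set (ℕ →₀ ℕ)) := by
    intro ν hν
    have hprod : ∏ j ∈ ν.support, (c * ((j : ℝ) + 1) ^ α) ^ (2 * ν j) ≤ s := by
      refine le_trans (le_mul_of_one_le_left (by positivity)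
        (one_le_pow₀ (n := ν.support.card) one_le_two)) ?_
      exact le_trans hν (by linarith)
    obtain ⟨hdeg, hsupp⟩ := degree_le_and_support_subset_of_prod_le hc hα hprod
    exact hS ν hsupp hdeg
  refine ⟨S.finite_toSet.subset hsub, ?_⟩
  refine le_trans (Nat.cast_le.mpr ?_)
    (floor_rpow_add_one_pow_floor_le (by positivity) (by positivity) hs)
  have := Set.ncard_le_ncard hsub S.finite_toSet
  rw [Set.ncard_coe_finset] at this
  exact this.trans hcard
end

section
/- Let β > 1 and define weights v_j = β^j for j ≥ 1. For s > 2 let J₀^s = { ν ∈ F : 2^{‖ν‖₀} ∏_{j ∈ supp ν} v_j^{2ν_j} ≤ s/2 } and set L = log_β(s/2). Then #J₀^s ≤ 1 + (1/(2π√L)) · (e³ √L)^{√L}. -/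
open Finset in
/-- Rankin's trick for the number of partitions of integers at most `N`. -/
theorem card_weight_le_mul_pow_le (N : ℕ) {q : ℝ} (hq0 : 0 < q) (hq1 : q < 1) :
    {ν : ℕ →₀ ℕ | (ν.sum fun j k => (j + 1) * k) ≤ N}.Finite ∧
    ({ν : ℕ →₀ ℕ | (ν.sum fun j k => (j + 1) * k) ≤ N}.ncard : ℝ) * q ^ N ≤
      ∏ j ∈ range N, (1 - q ^ (j + 1))⁻¹ := by
  set T : Finset (ℕ →₀ ℕ) := (range N).finsupp (fun _ => range (N + 1)) with hT
  have hsub : {ν : ℕ →₀ ℕ | (ν.sum fun j k => (j + 1) * k) ≤ N} ⊆ T := by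
    intro ν hν
    have hterm : ∀ j, (j + 1) * ν j ≤ N := by
      intro j
      by_cases hj : j ∈ ν.support
      · exact (Finset.single_le_sum (f := fun j => (j + 1) * ν j)
          (fun _ _ => Nat.zero_le _) hj).trans hν
      · simp [Finsupp.notMem_support_iff.mp hj]
    simp only [hT, mem_coe, mem_finsupp_iff]
    refine ⟨fun j hj => ?_, fun j _ => ?_⟩
    · have h1 : 1 ≤ ν j := Nat.one_le_iff_ne_zero.mpr (Finsupp.mem_support_iff.mp hj)
      have := hterm j
      rw [mem_range]
      nlinarith
    · have := hterm j
      rw [mem_range]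
      nlinarith
  have hfin := T.finite_toSet.subset hsub
  refine ⟨hfin, ?_⟩
  have hcard : {ν : ℕ →₀ ℕ | (ν.sum fun j k => (j + 1) * k) ≤ N}.ncard = #hfin.toFinset :=
    Set.ncard_eq_toFinset_card _ hfin
  have hsubT : hfin.toFinset ⊆ T := by
    intro ν hν
    exact hsub (hfin.mem_toFinset.mp hν)
  calc ({ν : ℕ →₀ ℕ | (ν.sum fun j k => (j + 1) * k) ≤ N}.ncard : ℝ) * q ^ N
      = ∑ ν ∈ hfin.toFinset, q ^ N := by rw [hcard, sum_const, nsmul_eq_mul]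
    _ ≤ ∑ ν ∈ hfin.toFinset, ∏ j ∈ range N, q ^ ((j + 1) * ν j) := by
        refine sum_le_sum fun ν hν => ?_
        have hw : (ν.sum fun j k => (j + 1) * k) ≤ N := hfin.mem_toFinset.mp hν
        rw [prod_pow_eq_pow_sum]
        refine pow_le_pow_of_le_one hq0.le hq1.le ?_
        rwa [Finsupp.sum_of_support_subset ν (mem_finsupp_iff.mp (hsubT hν)).1 _ (by simp)] at hw
    _ ≤ ∑ ν ∈ T, ∏ j ∈ range N, q ^ ((j + 1) * ν j) :=
        sum_le_sum_of_subset_of_nonneg hsubT fun _ _ _ => by positivity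
    _ = ∏ j ∈ range N, ∑ k ∈ range (N + 1), q ^ ((j + 1) * k) := by
        rw [prod_sum, hT, Finset.finsupp, sum_map]
        refine sum_congr (by congr!) fun p _ => ?_
        rw [← prod_attach (range N)]
        refine prod_congr rfl fun j _ => ?_
        simp [Finsupp.indicator_of_mem j.2]
    _ ≤ ∏ j ∈ range N, (1 - q ^ (j + 1))⁻¹ := by
        refine prod_le_prod (fun _ _ => by positivity) fun j _ => ?_
        have h0 : 0 ≤ q ^ (j + 1) := by positivity
        have h1 : q ^ (j + 1) < 1 := pow_lt_one₀ hq0.le hq1 (Nat.succ_ne_zero j)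
        simp_rw [pow_mul]
        rw [← tsum_geometric_of_lt_one h0 h1]
        exact (summable_geometric_of_lt_one h0 h1).sum_le_tsum _ fun _ _ => by positivity

/-- The Euler product bound `∏ (1 - e^{-tj})⁻¹ ≤ exp (π² / (6 t))`. -/
theorem prod_inv_one_sub_exp_le (N : ℕ) {t : ℝ} (ht : 0 < t) :
    ∏ j ∈ Finset.range N, (1 - Real.exp (-t) ^ (j + 1))⁻¹ ≤
      Real.exp (Real.pi ^ 2 / (6 * t)) := by
  set q := Real.exp (-t) with hq
  have hq0 : 0 < q := Real.exp_pos _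
  have hq1 : q < 1 := Real.exp_lt_one_iff.mpr (by linarith)
  have hlt (j : ℕ) : q ^ (j + 1) < 1 := pow_lt_one₀ hq0.le hq1 (Nat.succ_ne_zero j)
  have hlog (j : ℕ) : HasSum (fun k : ℕ => (q ^ (j + 1)) ^ (k + 1) / ((k : ℝ) + 1))
      (-Real.log (1 - q ^ (j + 1))) :=
    Real.hasSum_pow_div_log_of_abs_lt_one (by rw [abs_of_pos (by positivity)]; exact hlt j)
  have hsum := hasSum_sum (s := Finset.range N) fun j _ => hlog j
  have hzeta : HasSum (fun k : ℕ => 1 / t * (1 / ((k + 1 : ℕ) : ℝ) ^ 2))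
      (1 / t * (Real.pi ^ 2 / 6)) := by
    refine HasSum.mul_left _ ?_
    have := (hasSum_nat_add_iff' (f := fun n : ℕ => 1 / (n : ℝ) ^ 2) 1).mpr hasSum_zeta_two
    simpa using this
  have hle : ∑ j ∈ Finset.range N, -Real.log (1 - q ^ (j + 1)) ≤ 1 / t * (Real.pi ^ 2 / 6) := by
    refine hasSum_le (fun k => ?_) hsum hzeta
    have hk : (0 : ℝ) < (k : ℝ) + 1 := by positivity
    set r := q ^ (k + 1) with hr
    have hr0 : 0 < r := by positivity
    have hr1 : r < 1 := hlt k
    have hgeom : ∑ j ∈ Finset.range N, (q ^ (j + 1)) ^ (k + 1) ≤ r * (1 - r)⁻¹ := by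
      have : ∀ j ∈ Finset.range N, (q ^ (j + 1)) ^ (k + 1) = r * r ^ j := fun j _ => by
        rw [hr]; ring
      rw [Finset.sum_congr rfl this, ← Finset.mul_sum, ← tsum_geometric_of_lt_one hr0.le hr1]
      exact mul_le_mul_of_nonneg_left
        ((summable_geometric_of_lt_one hr0.le hr1).sum_le_tsum _ fun _ _ => by positivity) hr0.le
    have hrexp : r * Real.exp (t * (k + 1)) = 1 := by
      rw [hr, hq, ← Real.exp_nat_mul, ← Real.exp_add, Real.exp_eq_one_iff]
      push_cast
      ring
    have hru : r * (t * (k + 1)) ≤ 1 - r := by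
      have := mul_le_mul_of_nonneg_left (Real.add_one_le_exp (t * (k + 1))) hr0.le
      linarith
    have hfrac : r * (1 - r)⁻¹ ≤ 1 / (t * (k + 1)) := by
      rw [← div_eq_mul_inv, div_le_div_iff₀ (by linarith) (by positivity)]
      linarith
    rw [← Finset.sum_div]
    calc (∑ j ∈ Finset.range N, (q ^ (j + 1)) ^ (k + 1)) / ((k : ℝ) + 1)
        ≤ 1 / (t * (k + 1)) / ((k : ℝ) + 1) := by gcongr; exact hgeom.trans hfrac
      _ = 1 / t * (1 / ((k + 1 : ℕ) : ℝ) ^ 2) := by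
        push_cast
        field_simp
  have hprod : ∏ j ∈ Finset.range N, (1 - q ^ (j + 1))⁻¹ =
      Real.exp (∑ j ∈ Finset.range N, -Real.log (1 - q ^ (j + 1))) := by
    rw [Real.exp_sum]
    refine Finset.prod_congr rfl fun j _ => ?_
    rw [Real.exp_neg, Real.exp_log (by linarith [hlt j])]
  rw [hprod]
  refine Real.exp_le_exp.mpr (hle.trans_eq ?_)
  field_simp

theorem weight_le_of_two_pow_mul_prod_le {β s : ℝ} (hβ : 1 < β) (hs : 2 < s) {ν : ℕ →₀ ℕ}
    (hν : (2 : ℝ) ^ ν.support.card * ∏ j ∈ ν.support, (β ^ (j + 1)) ^ (2 * ν j) ≤ s / 2) :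
    (ν.sum fun j k => (j + 1) * k) ≤ ⌊Real.logb β (s / 2) / 2⌋₊ := by
  have hprod : ∏ j ∈ ν.support, (β ^ (j + 1)) ^ (2 * ν j) =
      β ^ (2 * ν.sum fun j k => (j + 1) * k) := by
    rw [Finsupp.sum, Finset.mul_sum, ← Finset.prod_pow_eq_pow_sum]
    refine Finset.prod_congr rfl fun j _ => ?_
    rw [← pow_mul]
    ring
  rw [hprod] at hν
  have hβ0 : 0 < β := by linarith
  have hpow : β ^ (2 * ν.sum fun j k => (j + 1) * k) ≤ s / 2 :=
    (le_mul_of_one_le_left (by positivity) (one_le_pow₀ one_le_two)).trans hν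
  rw [← Real.rpow_natCast, ← Real.le_logb_iff_rpow_le hβ (by linarith)] at hpow
  refine Nat.le_floor ?_
  push_cast at hpow ⊢
  linarith

theorem exp_three_mul_mul_le_rpow {x : ℝ} (hx : 1 ≤ x) :
    Real.exp (3 * x) * x ≤ (Real.exp 1 ^ (3 : ℕ) * x) ^ x := by
  have hx0 : 0 ≤ x := by linarith
  rw [Real.mul_rpow (by positivity) hx0, ← Real.exp_nat_mul, ← Real.exp_mul]
  have hxx : x ≤ x ^ x := by
    simpa using Real.rpow_le_rpow_of_exponent_le hx hx
  norm_num
  exact mul_le_mul_of_nonneg_left hxx (Real.exp_pos _).le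

/-- cardinality of the index set for exponentially growing weights `vⱼ = βʲ`
(`j ≥ 1`; in 0-based indexing `v` at index `j` is `β^{j+1}`). For `s > 2` and
`L = log_β(s/2)`, the set `J₀ˢ = {ν ∈ F : 2^{‖ν‖₀} ∏_{j ∈ supp ν} vⱼ^{2νⱼ} ≤ s/2}` satisfies
`#J₀ˢ ≤ 1 + (1/(2π√L)) (e³ √L)^{√L}`. -/
theorem stmt16 (β : ℝ) (hβ : 1 < β) (s : ℝ) (hs : 2 < s)
    (J : Set (ℕ →₀ ℕ))
    (hJ : J = {ν : ℕ →₀ ℕ |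
      (2 : ℝ) ^ ν.support.card *
        ∏ j ∈ ν.support, (β ^ (j + 1)) ^ (2 * ν j) ≤ s / 2}) :
    J.Finite ∧
    (J.ncard : ℝ) ≤ 1 +
      1 / (2 * Real.pi * Real.sqrt (Real.logb β (s / 2))) *
        (Real.exp 1 ^ (3 : ℕ) * Real.sqrt (Real.logb β (s / 2))) ^
          Real.sqrt (Real.logb β (s / 2)) := by
  set L := Real.logb β (s / 2) with hL
  have hL0 : 0 < L := Real.logb_pos hβ (by linarith)
  set x := Real.sqrt L with hx
  have hx0 : 0 < x := Real.sqrt_pos.mpr hL0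
  have hx2 : x ^ 2 = L := Real.sq_sqrt hL0.le
  set N := ⌊L / 2⌋₊ with hN
  have hNL : (N : ℝ) ≤ L / 2 := Nat.floor_le (by positivity)
  have hsub : J ⊆ {ν : ℕ →₀ ℕ | (ν.sum fun j k => (j + 1) * k) ≤ N} := by
    rw [hJ]
    exact fun ν hν => weight_le_of_two_pow_mul_prod_le hβ hs hν
  have hfin := (card_weight_le_mul_pow_le N (q := 1 / 2) (by norm_num) (by norm_num)).1
  refine ⟨hfin.subset hsub, ?_⟩
  have hcount {q : ℝ} (hq0 : 0 < q) (hq1 : q < 1) :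
      (J.ncard : ℝ) * q ^ N ≤ ∏ j ∈ Finset.range N, (1 - q ^ (j + 1))⁻¹ := by
    refine le_trans ?_ (card_weight_le_mul_pow_le N hq0 hq1).2
    have : (J.ncard : ℝ) ≤ _ := Nat.cast_le.mpr (Set.ncard_le_ncard hsub hfin)
    gcongr
  have hpi := Real.pi_pos
  have hlower (h1 : 1 ≤ x) : Real.exp (3 * x) / (2 * Real.pi) ≤
      1 / (2 * Real.pi * x) * (Real.exp 1 ^ (3 : ℕ) * x) ^ x := by
    calc Real.exp (3 * x) / (2 * Real.pi)
        = 1 / (2 * Real.pi * x) * (Real.exp (3 * x) * x) := by field_simp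
      _ ≤ _ := by gcongr; exact exp_three_mul_mul_le_rpow h1
  have he := Real.exp_one_gt_d9
  rcases lt_or_ge N 2 with hN2 | hN2
  · interval_cases hNv : N
    · have h := hcount (q := 1 / 2) (by norm_num) (by norm_num)
      have hpos : 0 ≤ 1 / (2 * Real.pi * x) * (Real.exp 1 ^ (3 : ℕ) * x) ^ x := by positivity
      norm_num at h
      have h' : (J.ncard : ℝ) ≤ 1 := by exact_mod_cast h
      linarith
    · have h := hcount (q := 1 / 2) (by norm_num) (by norm_num)
      norm_num at h
      have h1 : 1 ≤ x := by
        push_cast at hNL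
        nlinarith
      have h3 : 3 ≤ Real.exp (3 * x) / (2 * Real.pi) := by
        rw [le_div_iff₀ (by positivity)]
        have h20 : (20 : ℝ) ≤ Real.exp 1 ^ 3 := by
          calc (20 : ℝ) ≤ 2.7182818283 ^ 3 := by norm_num
            _ ≤ _ := by gcongr
        have hexp : Real.exp 1 ^ 3 ≤ Real.exp (3 * x) := by
          rw [← Real.exp_nat_mul]
          refine Real.exp_le_exp.mpr ?_
          push_cast
          linarith
        linarith [Real.pi_lt_d2]
      linarith [hlower h1]
  · have hN2' : (2 : ℝ) ≤ N := by exact_mod_cast hN2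
    have hx2' : 2 ≤ x := by nlinarith
    have ht : 0 < 2 / x := by positivity
    have h := (hcount (Real.exp_pos _) (Real.exp_lt_one_iff.mpr (neg_lt_zero.mpr ht))).trans
      (prod_inv_one_sub_exp_le N ht)
    rw [← Real.exp_nat_mul, ← le_div_iff₀ (Real.exp_pos _), ← Real.exp_sub] at h
    have hNt : N * (2 / x) ≤ x := by
      rw [mul_div_assoc', div_le_iff₀ hx0]
      nlinarith
    have hpit : Real.pi ^ 2 / (6 * (2 / x)) ≤ 5 / 6 * x := by
      have hpi2 : Real.pi ^ 2 ≤ 10 := by nlinarith [Real.pi_lt_d2]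
      have : Real.pi ^ 2 / (6 * (2 / x)) = Real.pi ^ 2 * x / 12 := by
        field_simp
        norm_num
      rw [this]
      nlinarith
    have hcard : (J.ncard : ℝ) ≤ Real.exp (11 / 6 * x) :=
      h.trans (Real.exp_le_exp.mpr (by linarith))
    have hmain : Real.exp (11 / 6 * x) ≤ Real.exp (3 * x) / (2 * Real.pi) := by
      rw [le_div_iff₀ (by positivity)]
      have hsplit : Real.exp (3 * x) = Real.exp (11 / 6 * x) * Real.exp (7 / 6 * x) := by
        rw [← Real.exp_add]
        ring_nf
      rw [hsplit]
      have hexp : Real.exp 1 ^ 2 ≤ Real.exp (7 / 6 * x) := by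
        rw [← Real.exp_nat_mul]
        refine Real.exp_le_exp.mpr ?_
        push_cast
        linarith
      refine mul_le_mul_of_nonneg_left ?_ (Real.exp_pos _).le
      nlinarith [Real.pi_lt_d2]
    linarith [hlower (by linarith)]
end
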